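/- arXiv:1904.00989 — 2 statements merged into one kernel-verified Lean document; each statement's English description precedes it below -/
import Mathlib

section
/- Strong duality for extreme counterfactuals (Lemmas 1 and 2(ii)): under Assumptions Φ(i) and Φ(ii), if Condition S holds at (θ,γ,P) and δ*(θ;γ,P) < δ, then κ̲_δ(θ;γ,P) = κ̲*_δ(θ;γ,P) and κ̄_δ(θ;γ,P) = κ̄*_δ(θ;γ,P); moreover the supremum defining κ̲*_δ(θ;γ,P) and the infimum defining κ̄*_δ(θ;γ,P) are unchanged if taken over (η,ζ,λ) ∈ (0,∞)×ℝ×Λ instead of [0,∞)×ℝ×Λ. -/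
open MeasureTheory Filter Set
open scoped ENNReal Pointwise Classical

noncomputable section

namespace CFSens

/-- map an extended real to `ℝ≥0∞` (negatives go to `0`; only used on nonnegative values). -/
def erealToENNReal (x : EReal) : ℝ≥0∞ := if x = ⊤ then ⊤ else ENNReal.ofReal x.toReal

/-- Euclidean dot product. -/
def dot {ι : Type*} [Fintype ι] (a b : ι → ℝ) : ℝ := ∑ i, a i * b i

/-- Convex conjugate `φ*(x) = sup_{t ≥ 0} (t x - φ t)` (`EReal`-valued). -/
def phiStar (φ : ℝ → ℝ) (x : ℝ) : EReal :=
  ⨆ t ∈ Set.Ici (0:ℝ), ((t * x - φ t : ℝ) : EReal)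

/-- Convex conjugate `(ηφ)*(x) = sup_{t ≥ 0} (t x - η φ t)` of `ηφ`, for `η ≥ 0`. -/
def etaPhiStar (φ : ℝ → ℝ) (η x : ℝ) : EReal :=
  ⨆ t ∈ Set.Ici (0:ℝ), ((t * x - η * φ t : ℝ) : EReal)

/-- `ψ(x) = φ*(x) - x`. -/
def psi (φ : ℝ → ℝ) (x : ℝ) : EReal := phiStar φ x - (x : EReal)

/-- Assumption Φ(i).  Here `φ : ℝ → ℝ` records the (finite) values of the divergence cost
on `[0,∞)`; the paper's extension `φ(x) = +∞` for `x < 0` is encoded separately wherever it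
matters (nonnegativity of densities), and `φ(0) < ∞` is automatic since `φ` is real-valued. -/
structure PhiOne (φ : ℝ → ℝ) : Prop where
  smooth : ContDiffOn ℝ 2 φ (Set.Ioi (0:ℝ))
  sconvex : StrictConvexOn ℝ (Set.Ici (0:ℝ)) φ
  one : φ 1 = 0
  done : deriv φ 1 = 0
  superlinear : Tendsto (fun x => φ x / x) atTop atTop
  dzero : ∃ L : EReal, L < 0 ∧
    Tendsto (fun x => ((deriv φ x : ℝ) : EReal)) (nhdsWithin 0 (Set.Ioi 0)) (nhds L)
  dinfty : ∃ L : EReal, 0 < L ∧ Tendsto (fun x => ((deriv φ x : ℝ) : EReal)) atTop (nhds L)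
  delta2 : ∃ L : ℝ, Tendsto (fun x => x * deriv φ x / φ x) atTop (nhds L)

variable {U : Type*} [MeasurableSpace U] {dθ d1 d2 d3 d4 : ℕ} {Γ : Type*}

/-- Stacked moment values/multipliers `(v1,v2,v3,v4)`. -/
abbrev Vec4 (d1 d2 d3 d4 : ℕ) :=
  (Fin d1 → ℝ) × (Fin d2 → ℝ) × (Fin d3 → ℝ) × (Fin d4 → ℝ)

/-- The targeted moments `P = (P1,P2)`. -/
abbrev Vec12 (d1 d2 : ℕ) := (Fin d1 → ℝ) × (Fin d2 → ℝ)

/-- `λ'g` for stacked vectors. -/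
def dot4 (a b : Vec4 d1 d2 d3 d4) : ℝ :=
  dot a.1 b.1 + dot a.2.1 b.2.1 + dot a.2.2.1 b.2.2.1 + dot a.2.2.2 b.2.2.2

/-- dot product on `Vec12`. -/
def dot12 (a b : Vec12 d1 d2) : ℝ := dot a.1 b.1 + dot a.2 b.2

/-- `λ ∈ Λ`, i.e. the multipliers on the inequality constraints are nonnegative. -/
def inLambda (l : Vec4 d1 d2 d3 d4) : Prop := (∀ i, 0 ≤ l.1 i) ∧ (∀ i, 0 ≤ l.2.2.1 i)

/-- `λ12'P`. -/
def dotP (l : Vec4 d1 d2 d3 d4) (P : Vec12 d1 d2) : ℝ := dot l.1 P.1 + dot l.2.1 P.2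

/-- The φ-divergence `D_φ(F‖F*)` (`= +∞` unless `F ≪ F*`). -/
def Dphi (φ : ℝ → ℝ) (Fstar F : Measure U) : ℝ≥0∞ :=
  if F ≪ Fstar then ∫⁻ u, ENNReal.ofReal (φ (F.rnDeriv Fstar u).toReal) ∂Fstar else ⊤

/-- Membership in the Orlicz heart `ℰ`: `∫ ψ(c|f|) dF* < ∞` for all `c > 0`. -/
def MemE (φ : ℝ → ℝ) (Fstar : Measure U) (f : U → ℝ) : Prop :=
  Measurable f ∧ ∀ c : ℝ, 0 < c → ∫⁻ u, erealToENNReal (psi φ (c * |f u|)) ∂Fstar < ⊤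

/-- The Orlicz norm `‖f‖_ψ = inf_{c>0} c⁻¹ (1 + ∫ ψ(c|f|) dF*)`. -/
def psiNorm (φ : ℝ → ℝ) (Fstar : Measure U) (f : U → ℝ) : ℝ≥0∞ :=
  ⨅ c ∈ Set.Ioi (0:ℝ),
    (ENNReal.ofReal c)⁻¹ * (1 + ∫⁻ u, erealToENNReal (psi φ (c * |f u|)) ∂Fstar)

/-- `E^{F*}[f]` for an `EReal`-valued integrand bounded below by `-c`. -/
def eExp (Fstar : Measure U) (c : ℝ) (f : U → EReal) : EReal :=
  ((∫⁻ u, erealToENNReal (f u + (c : EReal)) ∂Fstar : ℝ≥0∞) : EReal) - (c : EReal)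

/-- Sequential lower hemicontinuity of a correspondence `A` (sequences taken in `S`). -/
def LowerHemicontinuousAt {α β : Type*} [TopologicalSpace α] [TopologicalSpace β]
    (A : α → Set β) (S : Set α) (x : α) : Prop :=
  ∀ xs : ℕ → α, (∀ n, xs n ∈ S) → Tendsto xs atTop (nhds x) →
    ∀ y ∈ A x, ∃ ys : ℕ → β, (∀ n, ys n ∈ A (xs n)) ∧ Tendsto ys atTop (nhds y)

section Model

variable (φ : ℝ → ℝ) (Fstar : Measure U)
variable (g : U → (Fin dθ → ℝ) → Γ → Vec4 d1 d2 d3 d4)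
variable (k : U → (Fin dθ → ℝ) → Γ → ℝ)

/-- All components of `g(·,θ,γ)` are integrable under `F`. -/
def GIntegrable (θ : Fin dθ → ℝ) (γ : Γ) (F : Measure U) : Prop :=
  (∀ i, Integrable (fun u => (g u θ γ).1 i) F) ∧
  (∀ i, Integrable (fun u => (g u θ γ).2.1 i) F) ∧
  (∀ i, Integrable (fun u => (g u θ γ).2.2.1 i) F) ∧
  (∀ i, Integrable (fun u => (g u θ γ).2.2.2 i) F)

/-- The model constraints (1)–(4): `E^F[g1] ≤ P1`, `E^F[g2] = P2`, `E^F[g3] ≤ 0`, `E^F[g4] = 0`. -/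
def ConstraintsHold (θ : Fin dθ → ℝ) (γ : Γ) (P : Vec12 d1 d2) (F : Measure U) : Prop :=
  GIntegrable g θ γ F ∧
  (∀ i, ∫ u, (g u θ γ).1 i ∂F ≤ P.1 i) ∧
  (∀ i, ∫ u, (g u θ γ).2.1 i ∂F = P.2 i) ∧
  (∀ i, ∫ u, (g u θ γ).2.2.1 i ∂F ≤ 0) ∧
  (∀ i, ∫ u, (g u θ γ).2.2.2 i ∂F = 0)

/-- `F ∈ N_δ` and the model constraints hold at `(θ,γ,P)` under `F`. -/
def Feasible (δ : ℝ) (θ : Fin dθ → ℝ) (γ : Γ) (P : Vec12 d1 d2) (F : Measure U) : Prop :=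
  IsProbabilityMeasure F ∧ Dphi φ Fstar F ≤ ENNReal.ofReal δ ∧ ConstraintsHold g θ γ P F

/-- `κ̲_δ(θ;γ,P)`: primal lower value (explicit-dependence case); `= ⊤` if infeasible. -/
def kappaLow (δ : ℝ) (θ : Fin dθ → ℝ) (γ : Γ) (P : Vec12 d1 d2) : EReal :=
  sInf {x : EReal | ∃ F : Measure U, Feasible φ Fstar g δ θ γ P F ∧
    Integrable (fun u => k u θ γ) F ∧ x = ((∫ u, k u θ γ ∂F : ℝ) : EReal)}

/-- `κ̄_δ(θ;γ,P)`: primal upper value (explicit-dependence case); `= ⊥` if infeasible. -/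
def kappaHigh (δ : ℝ) (θ : Fin dθ → ℝ) (γ : Γ) (P : Vec12 d1 d2) : EReal :=
  sSup {x : EReal | ∃ F : Measure U, Feasible φ Fstar g δ θ γ P F ∧
    Integrable (fun u => k u θ γ) F ∧ x = ((∫ u, k u θ γ ∂F : ℝ) : EReal)}

/-- `κ̲*_δ(θ;γ,P)`: the dual program of `κ̲_δ`.  Multipliers with
`E^{F*}[(ηφ)*(...)] = +∞` contribute `-∞` to the supremum and are omitted from the
index set; `w` is a real-valued integrable version of the conjugate integrand. -/
def kappaLowDual (δ : ℝ) (θ : Fin dθ → ℝ) (γ : Γ) (P : Vec12 d1 d2) : EReal :=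
  sSup {x : EReal | ∃ η : ℝ, 0 ≤ η ∧ ∃ ζ : ℝ, ∃ l : Vec4 d1 d2 d3 d4, inLambda l ∧
    ∃ w : U → ℝ, Integrable w Fstar ∧
      (∀ᵐ u ∂Fstar, (w u : EReal) = etaPhiStar φ η (-(k u θ γ) - ζ - dot4 l (g u θ γ))) ∧
      x = ((-(∫ u, w u ∂Fstar) - η * δ - ζ - dotP l P : ℝ) : EReal)}

/-- `κ̄*_δ(θ;γ,P)`: the dual program of `κ̄_δ`. -/
def kappaHighDual (δ : ℝ) (θ : Fin dθ → ℝ) (γ : Γ) (P : Vec12 d1 d2) : EReal :=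
  sInf {x : EReal | ∃ η : ℝ, 0 ≤ η ∧ ∃ ζ : ℝ, ∃ l : Vec4 d1 d2 d3 d4, inLambda l ∧
    ∃ w : U → ℝ, Integrable w Fstar ∧
      (∀ᵐ u ∂Fstar, (w u : EReal) = etaPhiStar φ η (k u θ γ - ζ - dot4 l (g u θ γ))) ∧
      x = (((∫ u, w u ∂Fstar) + η * δ + ζ + dotP l P : ℝ) : EReal)}

/-- `δ*(θ;γ,P) = sup_{ζ,λ∈Λ} ( -E^{F*}[φ*(-ζ-λ'g)] - ζ - λ12'P )`. -/
def deltaStar (θ : Fin dθ → ℝ) (γ : Γ) (P : Vec12 d1 d2) : EReal :=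
  sSup {x : EReal | ∃ ζ : ℝ, ∃ l : Vec4 d1 d2 d3 d4, inLambda l ∧
    ∃ w : U → ℝ, Integrable w Fstar ∧
      (∀ᵐ u ∂Fstar, (w u : EReal) = phiStar φ (-ζ - dot4 l (g u θ γ))) ∧
      x = ((-(∫ u, w u ∂Fstar) - ζ - dotP l P : ℝ) : EReal)}

/-- `{E^F[g(U,θ,γ)] : F ∈ N_∞}`. -/
def momentSet (θ : Fin dθ → ℝ) (γ : Γ) : Set (Vec4 d1 d2 d3 d4) :=
  {v | ∃ F : Measure U, IsProbabilityMeasure F ∧ Dphi φ Fstar F < ⊤ ∧ GIntegrable g θ γ F ∧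
    v = ((fun i => ∫ u, (g u θ γ).1 i ∂F), (fun i => ∫ u, (g u θ γ).2.1 i ∂F),
         (fun i => ∫ u, (g u θ γ).2.2.1 i ∂F), (fun i => ∫ u, (g u θ γ).2.2.2 i ∂F))}

/-- The cone `𝒞 = ℝ^{d1}_{≥0} × {0} × ℝ^{d3}_{≥0} × {0}`. -/
def coneC : Set (Vec4 d1 d2 d3 d4) :=
  {c | (∀ i, 0 ≤ c.1 i) ∧ c.2.1 = 0 ∧ (∀ i, 0 ≤ c.2.2.1 i) ∧ c.2.2.2 = 0}

/-- Condition S at `(θ,γ,P)`. -/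
def ConditionS (θ : Fin dθ → ℝ) (γ : Γ) (P : Vec12 d1 d2) : Prop :=
  ((P.1, P.2, (0 : Fin d3 → ℝ), (0 : Fin d4 → ℝ)) : Vec4 d1 d2 d3 d4) ∈
    interior (momentSet φ Fstar g θ γ + coneC)

/-- Assumption Φ(ii): `k(·,θ,γ)` and each component of `g(·,θ,γ)` lie in `ℰ`. -/
def PhiTwo : Prop :=
  ∀ (θ : Fin dθ → ℝ) (γ : Γ), MemE φ Fstar (fun u => k u θ γ) ∧
    (∀ i, MemE φ Fstar (fun u => (g u θ γ).1 i)) ∧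
    (∀ i, MemE φ Fstar (fun u => (g u θ γ).2.1 i)) ∧
    (∀ i, MemE φ Fstar (fun u => (g u θ γ).2.2.1 i)) ∧
    (∀ i, MemE φ Fstar (fun u => (g u θ γ).2.2.2 i))

/-- `Θ_δ = {θ ∈ Θ : δ*(θ;γ0,P0) < δ}`. -/
def ThetaDelta (Θ : Set (Fin dθ → ℝ)) (γ0 : Γ) (P0 : Vec12 d1 d2) (δ : ℝ) :
    Set (Fin dθ → ℝ) :=
  {θ ∈ Θ | deltaStar φ Fstar g θ γ0 P0 < ((δ : ℝ) : EReal)}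

/-- Implicit-dependence lower value: `kI(θ,γ)` if feasible, `+∞` otherwise. -/
def kappaLowImp (kI : (Fin dθ → ℝ) → Γ → ℝ) (δ : ℝ) (θ : Fin dθ → ℝ) (γ : Γ)
    (P : Vec12 d1 d2) : EReal :=
  sInf {x : EReal | ∃ F : Measure U, Feasible φ Fstar g δ θ γ P F ∧ x = ((kI θ γ : ℝ) : EReal)}

/-- Implicit-dependence upper value: `kI(θ,γ)` if feasible, `-∞` otherwise. -/
def kappaHighImp (kI : (Fin dθ → ℝ) → Γ → ℝ) (δ : ℝ) (θ : Fin dθ → ℝ) (γ : Γ)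
    (P : Vec12 d1 d2) : EReal :=
  sSup {x : EReal | ∃ F : Measure U, Feasible φ Fstar g δ θ γ P F ∧ x = ((kI θ γ : ℝ) : EReal)}

/-- The criterion `K̲_δ(θ;γ,P)`. -/
def KLowCrit (δ : ℝ) (θ : Fin dθ → ℝ) (γ : Γ) (P : Vec12 d1 d2) : EReal :=
  if deltaStar φ Fstar g θ γ P < ((δ : ℝ) : EReal) then kappaLowDual φ Fstar g k δ θ γ P
  else if deltaStar φ Fstar g θ γ P = ((δ : ℝ) : EReal) then kappaLow φ Fstar g k δ θ γ P
  else ⊤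

/-- The criterion `K̄_δ(θ;γ,P)`. -/
def KHighCrit (δ : ℝ) (θ : Fin dθ → ℝ) (γ : Γ) (P : Vec12 d1 d2) : EReal :=
  if deltaStar φ Fstar g θ γ P < ((δ : ℝ) : EReal) then kappaHighDual φ Fstar g k δ θ γ P
  else if deltaStar φ Fstar g θ γ P = ((δ : ℝ) : EReal) then kappaHigh φ Fstar g k δ θ γ P
  else ⊥

/-- ℰ-continuity of a family `f(·,θ,γ)` in `(θ,γ)` on `Θ × Γ`. -/
def EContinuousIn [TopologicalSpace Γ] (Θ : Set (Fin dθ → ℝ))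
    (f : U → (Fin dθ → ℝ) → Γ → ℝ) : Prop :=
  ∀ θ0 ∈ Θ, ∀ γ0 : Γ,
    Tendsto (fun p : (Fin dθ → ℝ) × Γ => psiNorm φ Fstar (fun u => f u p.1 p.2 - f u θ0 γ0))
      (nhdsWithin (θ0, γ0) (Θ ×ˢ (Set.univ : Set Γ))) (nhds 0)

/-- Assumption M(i) for the moment functions. -/
def MOneG [TopologicalSpace Γ] (Θ : Set (Fin dθ → ℝ)) : Prop :=
  (∀ i, EContinuousIn φ Fstar Θ (fun u θ γ => (g u θ γ).1 i)) ∧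
  (∀ i, EContinuousIn φ Fstar Θ (fun u θ γ => (g u θ γ).2.1 i)) ∧
  (∀ i, EContinuousIn φ Fstar Θ (fun u θ γ => (g u θ γ).2.2.1 i)) ∧
  (∀ i, EContinuousIn φ Fstar Θ (fun u θ γ => (g u θ γ).2.2.2 i))

/-- Assumption M(v). -/
def MFive [TopologicalSpace Γ] (Θ : Set (Fin dθ → ℝ)) : Prop :=
  ∀ (c1 c2 : ℝ) (c3 : Vec4 d1 d2 d3 d4), ContinuousOn
    (fun p : (Fin dθ → ℝ) × Γ =>
      eExp Fstar (φ 0) (fun u => phiStar φ (c1 + c2 * k u p.1 p.2 + dot4 c3 (g u p.1 p.2))))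
    (Θ ×ˢ (Set.univ : Set Γ))

/-- Objective of the dual program for the lower value, as a function of `(η,ζ,λ)`. -/
def lowObj (δ : ℝ) (θ : Fin dθ → ℝ) (γ : Γ) (P : Vec12 d1 d2) (η ζ : ℝ)
    (l : Vec4 d1 d2 d3 d4) : EReal :=
  -(eExp Fstar (η * φ 0) (fun u => etaPhiStar φ η (-(k u θ γ) - ζ - dot4 l (g u θ γ))))
    - ((η * δ : ℝ) : EReal) - ((ζ : ℝ) : EReal) - ((dotP l P : ℝ) : EReal)

/-- Objective of the dual program for the upper value. -/
def highObj (δ : ℝ) (θ : Fin dθ → ℝ) (γ : Γ) (P : Vec12 d1 d2) (η ζ : ℝ)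
    (l : Vec4 d1 d2 d3 d4) : EReal :=
  (eExp Fstar (η * φ 0) (fun u => etaPhiStar φ η (k u θ γ - ζ - dot4 l (g u θ γ))))
    + ((η * δ : ℝ) : EReal) + ((ζ : ℝ) : EReal) + ((dotP l P : ℝ) : EReal)

/-- `Ξ̲_δ(θ)`: maximizers of the lower dual program. -/
def XiLow (δ : ℝ) (θ : Fin dθ → ℝ) (γ : Γ) (P : Vec12 d1 d2) :
    Set (ℝ × ℝ × Vec4 d1 d2 d3 d4) :=
  {ξ | 0 ≤ ξ.1 ∧ inLambda ξ.2.2 ∧ ∀ ξ' : ℝ × ℝ × Vec4 d1 d2 d3 d4, 0 ≤ ξ'.1 → inLambda ξ'.2.2 →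
    lowObj φ Fstar g k δ θ γ P ξ'.1 ξ'.2.1 ξ'.2.2 ≤ lowObj φ Fstar g k δ θ γ P ξ.1 ξ.2.1 ξ.2.2}

/-- `Ξ̄_δ(θ)`: minimizers of the upper dual program. -/
def XiHigh (δ : ℝ) (θ : Fin dθ → ℝ) (γ : Γ) (P : Vec12 d1 d2) :
    Set (ℝ × ℝ × Vec4 d1 d2 d3 d4) :=
  {ξ | 0 ≤ ξ.1 ∧ inLambda ξ.2.2 ∧ ∀ ξ' : ℝ × ℝ × Vec4 d1 d2 d3 d4, 0 ≤ ξ'.1 → inLambda ξ'.2.2 →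
    highObj φ Fstar g k δ θ γ P ξ.1 ξ.2.1 ξ.2.2 ≤ highObj φ Fstar g k δ θ γ P ξ'.1 ξ'.2.1 ξ'.2.2}

/-- `Λ̲_δ(θ)`: `(λ1,λ2)`-projections of `Ξ̲_δ(θ)`. -/
def LamLow (δ : ℝ) (θ : Fin dθ → ℝ) (γ : Γ) (P : Vec12 d1 d2) : Set (Vec12 d1 d2) :=
  {p | ∃ ξ ∈ XiLow φ Fstar g k δ θ γ P, ξ.2.2.1 = p.1 ∧ ξ.2.2.2.1 = p.2}

/-- `Λ̄_δ(θ)`: `(λ1,λ2)`-projections of `Ξ̄_δ(θ)`. -/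
def LamHigh (δ : ℝ) (θ : Fin dθ → ℝ) (γ : Γ) (P : Vec12 d1 d2) : Set (Vec12 d1 d2) :=
  {p | ∃ ξ ∈ XiHigh φ Fstar g k δ θ γ P, ξ.2.2.1 = p.1 ∧ ξ.2.2.2.1 = p.2}

end Model

end CFSens

namespace CFSens

variable {U : Type*} [MeasurableSpace U] {dθ d1 d2 d3 d4 : ℕ} {Γ : Type*}

/-- The lower dual program with the supremum restricted to `η > 0`. -/
def kappaLowDualPos (φ : ℝ → ℝ) (Fstar : Measure U)
    (g : U → (Fin dθ → ℝ) → Γ → Vec4 d1 d2 d3 d4) (k : U → (Fin dθ → ℝ) → Γ → ℝ)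
    (δ : ℝ) (θ : Fin dθ → ℝ) (γ : Γ) (P : Vec12 d1 d2) : EReal :=
  sSup {x : EReal | ∃ η : ℝ, 0 < η ∧ ∃ ζ : ℝ, ∃ l : Vec4 d1 d2 d3 d4, inLambda l ∧
    ∃ w : U → ℝ, Integrable w Fstar ∧
      (∀ᵐ u ∂Fstar, (w u : EReal) = etaPhiStar φ η (-(k u θ γ) - ζ - dot4 l (g u θ γ))) ∧
      x = ((-(∫ u, w u ∂Fstar) - η * δ - ζ - dotP l P : ℝ) : EReal)}

/-- The upper dual program with the infimum restricted to `η > 0`. -/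
def kappaHighDualPos (φ : ℝ → ℝ) (Fstar : Measure U)
    (g : U → (Fin dθ → ℝ) → Γ → Vec4 d1 d2 d3 d4) (k : U → (Fin dθ → ℝ) → Γ → ℝ)
    (δ : ℝ) (θ : Fin dθ → ℝ) (γ : Γ) (P : Vec12 d1 d2) : EReal :=
  sInf {x : EReal | ∃ η : ℝ, 0 < η ∧ ∃ ζ : ℝ, ∃ l : Vec4 d1 d2 d3 d4, inLambda l ∧
    ∃ w : U → ℝ, Integrable w Fstar ∧
      (∀ᵐ u ∂Fstar, (w u : EReal) = etaPhiStar φ η (k u θ γ - ζ - dot4 l (g u θ γ))) ∧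
      x = (((∫ u, w u ∂Fstar) + η * δ + ζ + dotP l P : ℝ) : EReal)}

end CFSens

open CFSens

/-- The consequences of Assumption Φ(i) used for duality. -/
structure RegularCost (φ : ℝ → ℝ) : Prop where
  convex : ConvexOn ℝ (Ici (0 : ℝ)) φ
  nonneg : ∀ t, 0 ≤ t → 0 ≤ φ t
  one : φ 1 = 0
  cont : ContinuousOn φ (Ioi (0 : ℝ))
  bound : ∀ y : ℝ, ∃ M : ℝ, ∀ t, 0 ≤ t → t * y - φ t ≤ M

theorem regularCost_of_phiOne {φ : ℝ → ℝ} (h : PhiOne φ) : RegularCost φ := by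
  have hconv := h.sconvex.convexOn
  have hdiff : HasDerivAt φ 0 1 := by
    have h1 : DifferentiableAt ℝ φ 1 :=
      (h.smooth.differentiableOn (by norm_num)).differentiableAt (Ioi_mem_nhds one_pos)
    simpa [h.done] using h1.hasDerivAt
  have hnn : ∀ t, 0 ≤ t → 0 ≤ φ t := by
    intro t ht
    have := hconv.isMinOn_of_rightDeriv_eq_zero (x := 1)
      (by rw [interior_Ici]; exact one_pos (α := ℝ)) (hdiff.hasDerivWithinAt.derivWithin
        (uniqueDiffWithinAt_Ioi 1))
    simpa [h.one] using this (show t ∈ Ici (0 : ℝ) from ht)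
  refine ⟨hconv, hnn, h.one, h.smooth.continuousOn, fun y => ?_⟩
  obtain ⟨M, hM⟩ := (h.superlinear.eventually_ge_atTop y).exists_forall_of_atTop
  refine ⟨max M 1 * |y|, fun t ht => ?_⟩
  rcases le_total t (max M 1) with htM | htM
  · have h1 : t * y ≤ t * |y| := mul_le_mul_of_nonneg_left (le_abs_self y) ht
    have h2 : t * |y| ≤ max M 1 * |y| := mul_le_mul_of_nonneg_right htM (abs_nonneg y)
    linarith [hnn t ht]
  · have htpos : 0 < t := lt_of_lt_of_le (by positivity) htM
    have h1 := hM t ((le_max_left _ _).trans htM)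
    rw [le_div_iff₀ htpos, mul_comm] at h1
    have : 0 ≤ max M 1 * |y| := by positivity
    linarith

/-- The real-valued convex conjugate of the cost. -/
def costConj (φ : ℝ → ℝ) (y : ℝ) : ℝ := (phiStar φ y).toReal

namespace RegularCost

variable {φ : ℝ → ℝ} (h : RegularCost φ)
include h

theorem coe_conj (y : ℝ) : ((costConj φ y : ℝ) : EReal) = phiStar φ y := by
  obtain ⟨M, hM⟩ := h.bound y
  refine EReal.coe_toReal (ne_of_lt ?_) (ne_of_gt ?_)
  · refine lt_of_le_of_lt (iSup₂_le fun t ht => ?_) (EReal.coe_lt_top M)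
    exact EReal.coe_le_coe_iff.2 (hM t ht)
  · refine lt_of_lt_of_le (EReal.bot_lt_coe (0 * y - φ 0)) ?_
    exact le_iSup₂ (f := fun (t : ℝ) (_ : t ∈ Ici (0 : ℝ)) => ((t * y - φ t : ℝ) : EReal)) 0
      (mem_Ici.2 le_rfl)

theorem le_conj {t : ℝ} (ht : 0 ≤ t) (y : ℝ) : t * y - φ t ≤ costConj φ y := by
  rw [← EReal.coe_le_coe_iff, h.coe_conj]
  exact le_iSup₂ (f := fun (t : ℝ) (_ : t ∈ Ici (0 : ℝ)) => ((t * y - φ t : ℝ) : EReal)) t ht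

theorem conj_le {y B : ℝ} (hB : ∀ t, 0 ≤ t → t * y - φ t ≤ B) : costConj φ y ≤ B := by
  rw [← EReal.coe_le_coe_iff, h.coe_conj]
  exact iSup₂_le fun t ht => EReal.coe_le_coe_iff.2 (hB t ht)

theorem conj_mono : Monotone (costConj φ) := fun _ y hxy => h.conj_le fun _ ht =>
  (sub_le_sub_right (mul_le_mul_of_nonneg_left hxy ht) _).trans (h.le_conj ht y)

theorem measurable_conj : Measurable (costConj φ) := h.conj_mono.measurable

theorem neg_zero_le_conj (y : ℝ) : -φ 0 ≤ costConj φ y := by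
  simpa using h.le_conj le_rfl y

theorem le_conj_self (y : ℝ) : y ≤ costConj φ y := by
  simpa [h.one] using h.le_conj zero_le_one y

theorem conj_add_le (x y : ℝ) :
    costConj φ (x + y) ≤ (costConj φ (2 * x) + costConj φ (2 * y)) / 2 := by
  refine h.conj_le fun t ht => ?_
  linarith [h.le_conj ht (2 * x), h.le_conj ht (2 * y)]

theorem etaPhiStar_eq {η : ℝ} (hη : 0 < η) (y : ℝ) :
    etaPhiStar φ η y = ((η * costConj φ (y / η) : ℝ) : EReal) := by
  have key : ∀ t, t * y - η * φ t = η * (t * (y / η) - φ t) := by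
    intro t; field_simp
  refine le_antisymm (iSup₂_le fun t ht => EReal.coe_le_coe_iff.2 ?_) ?_
  · rw [key]
    exact mul_le_mul_of_nonneg_left (h.le_conj ht _) hη.le
  · refine EReal.le_of_forall_lt_iff_le.1 fun z hz => ?_
    have h1 : costConj φ (y / η) ≤ z / η := by
      refine h.conj_le fun t ht => ?_
      have h2 : ((t * y - η * φ t : ℝ) : EReal) ≤ z :=
        (le_iSup₂ (f := fun (t : ℝ) (_ : t ∈ Ici (0 : ℝ)) => ((t * y - η * φ t : ℝ) : EReal)) t
          ht).trans hz.le
      rw [EReal.coe_le_coe_iff, key] at h2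
      rwa [le_div_iff₀' hη]
    rw [EReal.coe_le_coe_iff]
    rwa [le_div_iff₀' hη] at h1

theorem exists_rat_conj_lt (y : ℝ) {ε : ℝ} (hε : 0 < ε) :
    ∃ q : ℚ, 0 ≤ q ∧ costConj φ y - ε < q * y - φ q := by
  by_contra! hcon
  have key : costConj φ y ≤ costConj φ y - ε := by
    refine h.conj_le fun t ht => ?_
    rcases ht.eq_or_lt with rfl | htpos
    · simpa using hcon 0 le_rfl
    · have hc : ContinuousAt (fun s : ℝ => s * y - φ s) t :=
        (continuousAt_id.mul continuousAt_const).sub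
          (h.cont.continuousAt (Ioi_mem_nhds htpos))
      by_contra! hlt
      have hev := (hc.eventually (lt_mem_nhds hlt)).and (Ioi_mem_nhds htpos)
      obtain ⟨a, b, ⟨ha, hb⟩, hab⟩ := (mem_nhds_iff_exists_Ioo_subset).1 hev
      obtain ⟨q, hq1, hq2⟩ := exists_rat_btwn ha
      have := hab ⟨hq1.trans_le' le_rfl, hq2.trans hb⟩
      have hq0 : (0 : ℝ) < q := this.2
      exact absurd (hcon q (by exact_mod_cast hq0.le)) (not_le.2 this.1)
  linarith

theorem measurable_comp {U : Type*} [MeasurableSpace U] {x : U → ℝ} (hx : Measurable x)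
    (hx0 : ∀ u, 0 ≤ x u) : Measurable fun u => φ (x u) := by
  have h1 : Measurable ((Ioi (0 : ℝ)).piecewise φ fun _ => φ 0) :=
    h.cont.measurable_piecewise continuousOn_const measurableSet_Ioi
  convert h1.comp hx using 2 with u
  rcases (hx0 u).eq_or_lt with h0 | h0
  · simp [Set.piecewise, ← h0]
  · simp [Set.piecewise, h0]

end RegularCost

/-- The Orlicz heart, in terms of the real-valued conjugate. -/
def OrliczHeart (φ : ℝ → ℝ) {U : Type*} [MeasurableSpace U] (μ : Measure U) (f : U → ℝ) : Prop :=
  Measurable f ∧ ∀ c : ℝ, 0 ≤ c → Integrable (fun u => costConj φ (c * |f u|)) μ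

/-- Nonnegative densities with finite cost. -/
structure IsDensity (φ : ℝ → ℝ) {U : Type*} [MeasurableSpace U] (μ : Measure U)
    (x : U → ℝ) : Prop where
  measurable : Measurable x
  nonneg : ∀ u, 0 ≤ x u
  integrable_cost : Integrable (fun u => φ (x u)) μ

section OrliczHeart

variable {φ : ℝ → ℝ} {U : Type*} [MeasurableSpace U] {μ : Measure U} [IsProbabilityMeasure μ]

theorem OrliczHeart.of_memE (h : RegularCost φ) {f : U → ℝ} (hf : MemE φ μ f) :
    OrliczHeart φ μ f := by
  refine ⟨hf.1, fun c hc => ?_⟩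
  rcases hc.eq_or_lt with rfl | hc
  · simp
  have hm : Measurable fun u => c * |f u| := by have := hf.1; fun_prop
  have hnn : ∀ y, 0 ≤ costConj φ y - y := fun y => sub_nonneg.2 (h.le_conj_self y)
  have h1 : Integrable (fun u => costConj φ (c * |f u|) - c * |f u|) μ := by
    refine ⟨((h.measurable_conj.comp hm).sub hm).aestronglyMeasurable, ?_⟩
    rw [hasFiniteIntegral_iff_ofReal (.of_forall fun u => hnn _)]
    convert hf.2 c hc using 3 with u
    rw [psi, ← h.coe_conj, ← EReal.coe_sub, erealToENNReal, if_neg (EReal.coe_ne_top _),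
      EReal.toReal_coe]
  have h2 : Integrable (fun u => c * |f u|) μ := by
    refine (h1.add (integrable_const (φ 2))).mono' hm.aestronglyMeasurable (.of_forall fun u => ?_)
    have h3 := h.le_conj zero_le_two (c * |f u|)
    rw [Real.norm_of_nonneg (by positivity)]
    simp only [Pi.add_apply]
    linarith
  exact (h1.add h2).congr (.of_forall fun u => by simp)

theorem OrliczHeart.const (c : ℝ) : OrliczHeart φ μ (fun _ => c) :=
  ⟨measurable_const, fun _ _ => integrable_const _⟩

omit [IsProbabilityMeasure μ] in
theorem OrliczHeart.const_mul {f : U → ℝ} (hf : OrliczHeart φ μ f) (a : ℝ) :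
    OrliczHeart φ μ (fun u => a * f u) := by
  refine ⟨hf.1.const_mul a, fun c hc => ?_⟩
  simpa [abs_mul, mul_assoc] using hf.2 (c * |a|) (by positivity)

omit [IsProbabilityMeasure μ] in
theorem OrliczHeart.neg {f : U → ℝ} (hf : OrliczHeart φ μ f) :
    OrliczHeart φ μ (fun u => -f u) := by
  simpa using hf.const_mul (-1)

omit [IsProbabilityMeasure μ] in
theorem OrliczHeart.add (h : RegularCost φ) {f g : U → ℝ} (hf : OrliczHeart φ μ f)
    (hg : OrliczHeart φ μ g) : OrliczHeart φ μ (fun u => f u + g u) := by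
  refine ⟨hf.1.add hg.1, fun c hc => ?_⟩
  have hm : Measurable fun u => c * |f u + g u| := by have := hf.1; have := hg.1; fun_prop
  refine (((hf.2 (2 * c) (by positivity)).add (hg.2 (2 * c) (by positivity))).div_const 2).mono'
    (h.measurable_conj.comp hm).aestronglyMeasurable (.of_forall fun u => ?_)
  have h0 : 0 ≤ c * |f u + g u| := by positivity
  rw [Real.norm_of_nonneg (h0.trans (h.le_conj_self _))]
  refine (h.conj_mono (mul_le_mul_of_nonneg_left (abs_add_le (f u) (g u)) hc)).trans ?_
  simpa only [mul_add, Pi.add_apply, mul_assoc] using h.conj_add_le (c * |f u|) (c * |g u|)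

theorem OrliczHeart.sum (h : RegularCost φ) {ι : Type*} (s : Finset ι) {f : ι → U → ℝ}
    (hf : ∀ i, OrliczHeart φ μ (f i)) : OrliczHeart φ μ (fun u => ∑ i ∈ s, f i u) := by
  induction s using Finset.induction_on with
  | empty => simpa using OrliczHeart.const 0
  | insert a s ha ih => simpa only [Finset.sum_insert ha] using (hf a).add h ih

theorem OrliczHeart.integrable_conj (h : RegularCost φ) {f : U → ℝ} (hf : OrliczHeart φ μ f) :
    Integrable (fun u => costConj φ (f u)) μ := by
  refine ((hf.2 1 zero_le_one).add (integrable_const (φ 0))).mono'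
    (h.measurable_conj.comp hf.1).aestronglyMeasurable (.of_forall fun u => ?_)
  have h1 := h.conj_mono (le_abs_self (f u))
  have h2 := h.neg_zero_le_conj (f u)
  have h3 := h.nonneg 0 le_rfl
  have h4 := (abs_nonneg (f u)).trans (h.le_conj_self |f u|)
  simp only [Pi.add_apply, one_mul, Real.norm_eq_abs]
  exact abs_le.2 ⟨by linarith, by linarith⟩

omit [IsProbabilityMeasure μ] in
theorem IsDensity.integrable_mul (h : RegularCost φ) {x f : U → ℝ} (hx : IsDensity φ μ x)
    (hf : OrliczHeart φ μ f) : Integrable (fun u => x u * f u) μ := by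
  refine (hx.integrable_cost.add (hf.2 1 zero_le_one)).mono'
    (hx.measurable.mul hf.1).aestronglyMeasurable (.of_forall fun u => ?_)
  have h1 := h.le_conj (hx.nonneg u) |f u|
  rw [norm_mul, Real.norm_of_nonneg (hx.nonneg u), Real.norm_eq_abs]
  simp only [Pi.add_apply, one_mul]
  linarith

theorem IsDensity.integrable (h : RegularCost φ) {x : U → ℝ} (hx : IsDensity φ μ x) :
    Integrable x μ := by
  simpa using hx.integrable_mul h (OrliczHeart.const 1)

theorem IsDensity.const {c : ℝ} (hc : 0 ≤ c) : IsDensity φ μ (fun _ => c) :=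
  ⟨measurable_const, fun _ => hc, integrable_const _⟩

omit [IsProbabilityMeasure μ] in
theorem IsDensity.convexCombination (h : RegularCost φ) {x y : U → ℝ} (hx : IsDensity φ μ x)
    (hy : IsDensity φ μ y) {a b : ℝ} (ha : 0 ≤ a) (hb : 0 ≤ b) (hab : a + b = 1) :
    IsDensity φ μ (fun u => a * x u + b * y u) ∧
      ∫ u, φ (a * x u + b * y u) ∂μ ≤ a * ∫ u, φ (x u) ∂μ + b * ∫ u, φ (y u) ∂μ := by
  have hm : Measurable fun u => a * x u + b * y u := by
    have := hx.measurable; have := hy.measurable; fun_prop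
  have hnn : ∀ u, 0 ≤ a * x u + b * y u := fun u =>
    add_nonneg (mul_nonneg ha (hx.nonneg u)) (mul_nonneg hb (hy.nonneg u))
  have hle : ∀ u, φ (a * x u + b * y u) ≤ a * φ (x u) + b * φ (y u) := fun u =>
    h.convex.2 (mem_Ici.2 (hx.nonneg u)) (mem_Ici.2 (hy.nonneg u)) ha hb hab
  have hi := (hx.integrable_cost.const_mul a).add (hy.integrable_cost.const_mul b)
  have hi' : Integrable (fun u => φ (a * x u + b * y u)) μ := by
    refine hi.mono' (h.measurable_comp hm hnn).aestronglyMeasurable (.of_forall fun u => ?_)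
    rw [Real.norm_of_nonneg (h.nonneg _ (hnn u))]
    exact hle u
  refine ⟨⟨hm, hnn, hi'⟩, (integral_mono hi' hi hle).trans_eq ?_⟩
  rw [← integral_const_mul, ← integral_const_mul]
  exact integral_add (hx.integrable_cost.const_mul a) (hy.integrable_cost.const_mul b)

/-- Interchange of supremum and integral: near-optimal densities can be selected measurably. -/
theorem OrliczHeart.integral_conj_le (h : RegularCost φ) {f : U → ℝ} (hf : OrliczHeart φ μ f)
    {R : ℝ} (hR : ∀ x, IsDensity φ μ x → ∫ u, (x u * f u - φ (x u)) ∂μ ≤ R) :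
    ∫ u, costConj φ (f u) ∂μ ≤ R := by
  refine le_of_forall_pos_le_add fun ε hε => ?_
  obtain ⟨e, he⟩ := exists_surjective_nat {q : ℚ // 0 ≤ q}
  have hex : ∀ u, ∃ n, costConj φ (f u) - ε < (e n : ℚ) * f u - φ (e n : ℚ) := fun u => by
    obtain ⟨q, hq, hq'⟩ := h.exists_rat_conj_lt (f u) hε
    obtain ⟨n, hn⟩ := he ⟨q, hq⟩
    exact ⟨n, by rw [hn]; exact hq'⟩
  have hN : Measurable fun u => Nat.find (hex u) := by
    refine measurable_find hex fun n => ?_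
    exact measurableSet_lt ((h.measurable_conj.comp hf.1).sub_const ε)
      ((hf.1.const_mul _).sub_const _)
  set x : U → ℝ := fun u => ((e (Nat.find (hex u)) : ℚ) : ℝ) with hxdef
  have hxm : Measurable x := by
    have : Measurable fun n : ℕ => ((e n : ℚ) : ℝ) := measurable_of_countable _
    exact this.comp hN
  have hx0 : ∀ u, 0 ≤ x u := fun u => by
    have := (e (Nat.find (hex u))).2
    simp only [hxdef]; exact_mod_cast this
  have hsel : ∀ u, costConj φ (f u) - ε < x u * f u - φ (x u) := fun u => Nat.find_spec (hex u)
  have hd : IsDensity φ μ x := by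
    refine ⟨hxm, hx0, ?_⟩
    refine ((hf.2 2 zero_le_two).add (integrable_const (2 * (φ 0 + ε)))).mono'
      (h.measurable_comp hxm hx0).aestronglyMeasurable (.of_forall fun u => ?_)
    rw [Real.norm_of_nonneg (h.nonneg _ (hx0 u))]
    have h1 := hsel u
    have h2 := h.neg_zero_le_conj (f u)
    have h3 := h.le_conj (hx0 u) (2 * |f u|)
    have h4 := mul_le_mul_of_nonneg_left (le_abs_self (f u)) (hx0 u)
    simp only [Pi.add_apply]
    linarith
  have hmain : ∫ u, (costConj φ (f u) - ε) ∂μ ≤ ∫ u, (x u * f u - φ (x u)) ∂μ :=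
    integral_mono ((hf.integrable_conj h).sub (integrable_const ε))
      ((hd.integrable_mul h hf).sub hd.integrable_cost) fun u => (hsel u).le
  rw [integral_sub (hf.integrable_conj h) (integrable_const ε)] at hmain
  simp only [integral_const, probReal_univ, one_smul] at hmain
  linarith [hR x hd]

end OrliczHeart

/-- In finite dimension, a point outside a nonempty convex set can be weakly separated from it,
whether or not the set has interior points. -/
theorem exists_separating_functional {E : Type*} [NormedAddCommGroup E] [NormedSpace ℝ E]
    [FiniteDimensional ℝ E] {A : Set E} (hA : Convex ℝ A) (hne : A.Nonempty) {z : E}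
    (hz : z ∉ A) : ∃ f : E →ₗ[ℝ] ℝ, f ≠ 0 ∧ ∀ a ∈ A, f z ≤ f a := by
  by_cases hint : (interior A).Nonempty
  · obtain ⟨f, hf⟩ := geometric_hahn_banach_open_point hA.interior isOpen_interior
      (fun h => hz (interior_subset h))
    refine ⟨-(f : E →ₗ[ℝ] ℝ), fun h0 => ?_, fun a ha => ?_⟩
    · obtain ⟨a, ha⟩ := hint
      have h1 := hf a ha
      have h2 : ∀ v, f v = 0 := fun v => by simpa using LinearMap.congr_fun h0 v
      simp [h2] at h1
    · have hcl : closure (interior A) ⊆ {v | f v ≤ f z} :=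
        closure_minimal (fun v hv => (hf v hv).le)
          (isClosed_le f.continuous continuous_const)
      rw [hA.closure_interior_eq_closure_of_nonempty_interior hint] at hcl
      have := hcl (subset_closure ha)
      simpa using this
  · rw [hA.interior_nonempty_iff_affineSpan_eq_top] at hint
    obtain ⟨a₀, ha₀⟩ := hne
    have hdir : (affineSpan ℝ A).direction < ⊤ := by
      refine lt_top_iff_ne_top.2 fun h => hint ?_
      exact (AffineSubspace.direction_eq_top_iff_of_nonempty
        ⟨a₀, subset_affineSpan ℝ A ha₀⟩).1 h
    obtain ⟨f, hf0, hf⟩ := Submodule.exists_le_ker_of_lt_top _ hdir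
    have hconst : ∀ a ∈ A, f a = f a₀ := fun a ha => by
      have := hf (AffineSubspace.vsub_mem_direction (subset_affineSpan ℝ A ha)
        (subset_affineSpan ℝ A ha₀))
      rw [LinearMap.mem_ker, vsub_eq_sub, map_sub] at this
      linarith
    rcases le_total (f z) (f a₀) with hle | hle
    · exact ⟨f, hf0, fun a ha => by rwa [hconst a ha]⟩
    · exact ⟨-f, neg_ne_zero.2 hf0, fun a ha => by simpa [hconst a ha] using hle⟩

theorem nonneg_of_forall_le_add_mul {C D a : ℝ} (h : ∀ s, 0 ≤ s → C ≤ D + s * a) : 0 ≤ a := by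
  by_contra! hneg
  obtain ⟨n, hn⟩ := exists_nat_gt ((D - C) / (-a))
  rw [div_lt_iff₀ (by linarith)] at hn
  have := h n n.cast_nonneg
  linarith

/-- Lagrange multipliers for a convex set of (objective, constraint) values under a constraint
qualification: no nonzero functional supports the constraint values at `w₀`. -/
theorem exists_multiplier {W : Type*} [NormedAddCommGroup W] [NormedSpace ℝ W]
    [FiniteDimensional ℝ W] {A : Set (ℝ × W)} (hA : Convex ℝ A) (hne : A.Nonempty)
    (hup : ∀ v w s, (v, w) ∈ A → 0 ≤ s → (v + s, w) ∈ A) {r : ℝ} {w₀ : W}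
    (hr : (r, w₀) ∉ A)
    (hq : ∀ f : W →ₗ[ℝ] ℝ, (∀ v w, (v, w) ∈ A → f w₀ ≤ f w) → f = 0) :
    ∃ f : W →ₗ[ℝ] ℝ, ∀ v w, (v, w) ∈ A → r + f w₀ ≤ v + f w := by
  obtain ⟨F, hF0, hF⟩ := exists_separating_functional hA hne hr
  set a := F (1, 0) with ha
  set f : W →ₗ[ℝ] ℝ := F ∘ₗ LinearMap.inr ℝ ℝ W with hf
  have hdecomp : ∀ v w, F (v, w) = a * v + f w := fun v w => by
    have : (v, w) = v • ((1 : ℝ), (0 : W)) + (0, w) := by simp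
    rw [this, map_add, map_smul, smul_eq_mul, mul_comm]
    rfl
  have hF' : ∀ v w, (v, w) ∈ A → a * r + f w₀ ≤ a * v + f w := fun v w hvw => by
    simpa only [hdecomp] using hF _ hvw
  have ha0 : 0 ≤ a := by
    obtain ⟨⟨v, w⟩, hvw⟩ := hne
    refine nonneg_of_forall_le_add_mul (C := a * r + f w₀) (D := a * v + f w) fun s hs => ?_
    have := hF' _ _ (hup v w s hvw hs)
    linarith
  rcases ha0.eq_or_lt with ha0 | hapos
  · exfalso
    have hf0 : f = 0 := hq f fun v w hvw => by simpa [← ha0] using hF' v w hvw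
    refine hF0 (LinearMap.ext fun ⟨v, w⟩ => ?_)
    rw [hdecomp, ← ha0, hf0]
    simp
  · refine ⟨a⁻¹ • f, fun v w hvw => ?_⟩
    have h1 := mul_le_mul_of_nonneg_left (hF' v w hvw) (inv_pos.2 hapos).le
    rw [mul_add, mul_add, inv_mul_cancel_left₀ hapos.ne', inv_mul_cancel_left₀ hapos.ne'] at h1
    simpa using h1

section Vectors

variable {d1 d2 d3 d4 : ℕ}

theorem exists_dot {ι : Type*} [Fintype ι] (f : (ι → ℝ) →ₗ[ℝ] ℝ) : ∃ a, ∀ b, f b = dot a b := by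
  refine ⟨fun i => f (Pi.single i 1), fun b => ?_⟩
  rw [LinearMap.pi_apply_eq_sum_univ f b, dot]
  refine Finset.sum_congr rfl fun i _ => ?_
  rw [smul_eq_mul, mul_comm]
  congr 2
  ext j
  simp [Pi.single_apply, eq_comm]

theorem exists_dot4 (f : Vec4 d1 d2 d3 d4 →ₗ[ℝ] ℝ) : ∃ l, ∀ p, f p = dot4 l p := by
  obtain ⟨l1, h1⟩ := exists_dot (f ∘ₗ LinearMap.inl ℝ _ _)
  obtain ⟨l2, h2⟩ := exists_dot (f ∘ₗ LinearMap.inr ℝ _ _ ∘ₗ LinearMap.inl ℝ _ _)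
  obtain ⟨l3, h3⟩ := exists_dot
    (f ∘ₗ LinearMap.inr ℝ _ _ ∘ₗ LinearMap.inr ℝ _ _ ∘ₗ LinearMap.inl ℝ _ _)
  obtain ⟨l4, h4⟩ := exists_dot
    (f ∘ₗ LinearMap.inr ℝ _ _ ∘ₗ LinearMap.inr ℝ _ _ ∘ₗ LinearMap.inr ℝ _ _)
  refine ⟨(l1, l2, l3, l4), fun ⟨p1, p2, p3, p4⟩ => ?_⟩
  simp only [dot4, ← h1, ← h2, ← h3, ← h4, LinearMap.comp_apply, ← map_add]
  simp

theorem dot_add {ι : Type*} [Fintype ι] (a b c : ι → ℝ) : dot a (b + c) = dot a b + dot a c := by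
  simp [dot, mul_add, Finset.sum_add_distrib]

theorem dot_smul {ι : Type*} [Fintype ι] (a b : ι → ℝ) (s : ℝ) : dot a (s • b) = s * dot a b := by
  simp only [dot, Finset.mul_sum, Pi.smul_apply, smul_eq_mul]
  exact Finset.sum_congr rfl fun i _ => by ring

theorem dot_nonneg {ι : Type*} [Fintype ι] {a b : ι → ℝ} (ha : ∀ i, 0 ≤ a i) (hb : ∀ i, 0 ≤ b i) :
    0 ≤ dot a b :=
  Finset.sum_nonneg fun i _ => mul_nonneg (ha i) (hb i)

theorem dot4_add (l a b : Vec4 d1 d2 d3 d4) : dot4 l (a + b) = dot4 l a + dot4 l b := by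
  simp only [dot4, Prod.fst_add, Prod.snd_add, dot_add]
  ring

theorem dot4_smul (l a : Vec4 d1 d2 d3 d4) (s : ℝ) : dot4 l (s • a) = s * dot4 l a := by
  simp only [dot4, Prod.smul_fst, Prod.smul_snd, dot_smul]
  ring

theorem dot4_nonneg {l c : Vec4 d1 d2 d3 d4} (hl : inLambda l) (hc : c ∈ coneC) :
    0 ≤ dot4 l c := by
  obtain ⟨h1, h2, h3, h4⟩ := hc
  simp only [dot4, h2, h4]
  have := dot_nonneg hl.1 h1
  have := dot_nonneg hl.2 h3
  simp only [dot, Pi.zero_apply, mul_zero, Finset.sum_const_zero] at *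
  linarith

theorem inLambda_of_dot4_nonneg {l : Vec4 d1 d2 d3 d4} (hl : ∀ c ∈ coneC, 0 ≤ dot4 l c) :
    inLambda l := by
  refine ⟨fun i => ?_, fun i => ?_⟩
  · have := hl (Pi.single i 1, 0, 0, 0)
      ⟨fun j => by by_cases h : j = i <;> simp [h], rfl, fun _ => le_rfl, rfl⟩
    simpa [dot4, dot, Pi.single_apply] using this
  · have := hl (0, 0, Pi.single i 1, 0)
      ⟨fun _ => le_rfl, rfl, fun j => by by_cases h : j = i <;> simp [h], rfl⟩
    simpa [dot4, dot, Pi.single_apply] using this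

theorem add_mem_coneC {a b : Vec4 d1 d2 d3 d4} (ha : a ∈ coneC) (hb : b ∈ coneC) :
    a + b ∈ coneC :=
  ⟨fun i => add_nonneg (ha.1 i) (hb.1 i), by simp [ha.2.1, hb.2.1],
    fun i => add_nonneg (ha.2.2.1 i) (hb.2.2.1 i), by simp [ha.2.2.2, hb.2.2.2]⟩

theorem smul_mem_coneC {a : Vec4 d1 d2 d3 d4} (ha : a ∈ coneC) {s : ℝ} (hs : 0 ≤ s) :
    s • a ∈ coneC :=
  ⟨fun i => mul_nonneg hs (ha.1 i), by simp [ha.2.1],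
    fun i => mul_nonneg hs (ha.2.2.1 i), by simp [ha.2.2.2]⟩

theorem zero_mem_coneC : (0 : Vec4 d1 d2 d3 d4) ∈ coneC :=
  ⟨fun _ => le_rfl, rfl, fun _ => le_rfl, rfl⟩

/-- A functional bounded below on a neighbourhood by its value at the centre vanishes. -/
theorem eq_zero_of_le_near {E : Type*} [NormedAddCommGroup E] [NormedSpace ℝ E] {S : Set E}
    {p : E} (hp : p ∈ interior S) (f : E →ₗ[ℝ] ℝ) (hf : ∀ q ∈ S, f p ≤ f q) : f = 0 := by
  ext v
  have hc : Continuous fun t : ℝ => p + t • v := by fun_prop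
  have hev : ∀ᶠ t : ℝ in nhds 0, p + t • v ∈ S :=
    hc.continuousAt.eventually (by simpa using mem_interior_iff_mem_nhds.1 hp)
  obtain ⟨ε, hε, hball⟩ := Metric.eventually_nhds_iff.1 hev
  have key : ∀ t : ℝ, |t| < ε → 0 ≤ t * f v := fun t ht => by
    have := hf _ (hball (by simpa using ht))
    simpa using this
  have h1 := key (ε / 2) (by rw [abs_of_pos] <;> linarith)
  have h2 := key (-(ε / 2)) (by rw [abs_neg, abs_of_pos] <;> linarith)
  simp only [LinearMap.zero_apply]
  nlinarith

end Vectors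

section Duality

variable {φ : ℝ → ℝ} {U : Type*} [MeasurableSpace U] {μ : Measure U} {d1 d2 d3 d4 : ℕ}

/-- All components of a stacked moment function lie in the Orlicz heart. -/
def OrliczHeartVec (φ : ℝ → ℝ) (μ : Measure U) (G : U → Vec4 d1 d2 d3 d4) : Prop :=
  (∀ i, OrliczHeart φ μ fun u => (G u).1 i) ∧ (∀ i, OrliczHeart φ μ fun u => (G u).2.1 i) ∧
  (∀ i, OrliczHeart φ μ fun u => (G u).2.2.1 i) ∧ (∀ i, OrliczHeart φ μ fun u => (G u).2.2.2 i)

/-- The moments of `G` under the density `x`. -/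
def moment (μ : Measure U) (G : U → Vec4 d1 d2 d3 d4) (x : U → ℝ) : Vec4 d1 d2 d3 d4 :=
  (fun i => ∫ u, x u * (G u).1 i ∂μ, fun i => ∫ u, x u * (G u).2.1 i ∂μ,
    fun i => ∫ u, x u * (G u).2.2.1 i ∂μ, fun i => ∫ u, x u * (G u).2.2.2 i ∂μ)

/-- Moment values compatible with the constraints under some probability density. -/
def attainable (φ : ℝ → ℝ) (μ : Measure U) (G : U → Vec4 d1 d2 d3 d4) :
    Set (Vec4 d1 d2 d3 d4) :=
  {p | ∃ x, IsDensity φ μ x ∧ ∫ u, x u ∂μ = 1 ∧ ∃ c ∈ coneC, moment μ G x + c = p}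

variable {G : U → Vec4 d1 d2 d3 d4} {K : U → ℝ}

theorem IsDensity.integral_combination (h : RegularCost φ) {x y : U → ℝ} (hx : IsDensity φ μ x)
    (hy : IsDensity φ μ y) {f : U → ℝ} (hf : OrliczHeart φ μ f) (a b : ℝ) :
    ∫ u, (a * x u + b * y u) * f u ∂μ = a * ∫ u, x u * f u ∂μ + b * ∫ u, y u * f u ∂μ := by
  rw [← integral_const_mul, ← integral_const_mul,
    ← integral_add ((hx.integrable_mul h hf).const_mul a) ((hy.integrable_mul h hf).const_mul b)]
  exact integral_congr_ae (.of_forall fun u => by ring)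

theorem moment_combination (h : RegularCost φ) (hG : OrliczHeartVec φ μ G) {x y : U → ℝ}
    (hx : IsDensity φ μ x) (hy : IsDensity φ μ y) (a b : ℝ) :
    moment μ G (fun u => a * x u + b * y u) = a • moment μ G x + b • moment μ G y := by
  refine Prod.ext (funext fun i => ?_) (Prod.ext (funext fun i => ?_)
    (Prod.ext (funext fun i => ?_) (funext fun i => ?_)))
  · exact hx.integral_combination h hy (hG.1 i) a b
  · exact hx.integral_combination h hy (hG.2.1 i) a b
  · exact hx.integral_combination h hy (hG.2.2.1 i) a b
  · exact hx.integral_combination h hy (hG.2.2.2 i) a b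

variable [IsProbabilityMeasure μ]

theorem OrliczHeart.dot (h : RegularCost φ) {ι : Type*} [Fintype ι] (a : ι → ℝ) {f : U → ι → ℝ}
    (hf : ∀ i, OrliczHeart φ μ fun u => f u i) : OrliczHeart φ μ fun u => dot a (f u) :=
  OrliczHeart.sum h _ fun i => (hf i).const_mul (a i)

theorem OrliczHeartVec.dot4 (h : RegularCost φ) (hG : OrliczHeartVec φ μ G)
    (l : Vec4 d1 d2 d3 d4) : OrliczHeart φ μ fun u => dot4 l (G u) :=
  (((OrliczHeart.dot h l.1 hG.1).add h (OrliczHeart.dot h l.2.1 hG.2.1)).add h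
    (OrliczHeart.dot h l.2.2.1 hG.2.2.1)).add h (OrliczHeart.dot h l.2.2.2 hG.2.2.2)

omit [IsProbabilityMeasure μ] in
theorem IsDensity.integral_mul_dot (h : RegularCost φ) {ι : Type*} [Fintype ι] (a : ι → ℝ)
    {f : U → ι → ℝ} (hf : ∀ i, OrliczHeart φ μ fun u => f u i) {x : U → ℝ}
    (hx : IsDensity φ μ x) :
    ∫ u, x u * CFSens.dot a (f u) ∂μ = CFSens.dot a fun i => ∫ u, x u * f u i ∂μ := by
  simp only [CFSens.dot, Finset.mul_sum, mul_left_comm (x _)]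
  rw [integral_finsetSum _ fun i _ => (hx.integrable_mul h (hf i)).const_mul (a i)]
  simp only [integral_const_mul]

theorem IsDensity.integral_mul_dot4 (h : RegularCost φ) (hG : OrliczHeartVec φ μ G) {x : U → ℝ}
    (hx : IsDensity φ μ x) (l : Vec4 d1 d2 d3 d4) :
    ∫ u, x u * CFSens.dot4 l (G u) ∂μ = CFSens.dot4 l (moment μ G x) := by
  have i1 := hx.integrable_mul h (OrliczHeart.dot h l.1 hG.1)
  have i2 := hx.integrable_mul h (OrliczHeart.dot h l.2.1 hG.2.1)
  have i3 := hx.integrable_mul h (OrliczHeart.dot h l.2.2.1 hG.2.2.1)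
  have i4 := hx.integrable_mul h (OrliczHeart.dot h l.2.2.2 hG.2.2.2)
  simp only [CFSens.dot4, mul_add]
  rw [integral_add ((i1.fun_add i2).fun_add i3) i4, integral_add (i1.fun_add i2) i3, integral_add i1 i2,
    hx.integral_mul_dot h _ hG.1, hx.integral_mul_dot h _ hG.2.1, hx.integral_mul_dot h _ hG.2.2.1,
    hx.integral_mul_dot h _ hG.2.2.2]
  rfl

theorem linearMap_eq_zero_of_interior_attainable {P : Vec4 d1 d2 d3 d4}
    (hP : P ∈ interior (attainable φ μ G)) (f : ℝ × Vec4 d1 d2 d3 d4 →ₗ[ℝ] ℝ)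
    (hf : ∀ x, IsDensity φ μ x → ∀ c ∈ coneC,
      f (1, P) ≤ f (∫ u, x u ∂μ, moment μ G x + c)) : f = 0 := by
  have hdecomp : ∀ m p, f (m, p) = m * f (1, 0) + f (0, p) := fun m p => by
    have : (m, p) = m • ((1 : ℝ), (0 : Vec4 d1 d2 d3 d4)) + (0, p) := by simp
    rw [this, map_add, map_smul, smul_eq_mul]
  have hr : f ∘ₗ LinearMap.inr ℝ ℝ _ = 0 := eq_zero_of_le_near hP _ fun q hq => by
    obtain ⟨x, hx, hx1, c, hc, rfl⟩ := hq
    have := hf x hx c hc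
    have h1 := hdecomp 1 P
    have h2 := hdecomp 1 (moment μ G x + c)
    rw [hx1] at this
    change f (0, P) ≤ f (0, moment μ G x + c)
    linarith
  have hr' : ∀ p, f (0, p) = 0 := fun p => LinearMap.congr_fun hr p
  have hconst : ∀ a : ℝ, 0 ≤ a → f (1, 0) ≤ a * f (1, 0) := fun a ha => by
    have h1 := hf _ (IsDensity.const ha) 0 zero_mem_coneC
    have h2 := hdecomp 1 P
    have h3 := hdecomp (∫ _, a ∂μ) (moment μ G (fun _ => a) + 0)
    rw [hr'] at h2 h3
    rw [h2, h3] at h1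
    simpa using h1
  have hz : f (1, 0) = 0 := by
    linarith [hconst 0 le_rfl, hconst 2 zero_le_two]
  refine LinearMap.ext fun ⟨m, p⟩ => ?_
  rw [hdecomp, hr', hz]
  simp

/-- If the dual bound `δ*` is below `δ`, some feasible density has cost below `δ`. -/
theorem exists_slater_density (h : RegularCost φ) (hG : OrliczHeartVec φ μ G)
    {P : Vec4 d1 d2 d3 d4} (hP : P ∈ interior (attainable φ μ G)) {δ' δ : ℝ} (hδ : δ' < δ)
    (hdual : ∀ ζ l, inLambda l →
      -(∫ u, costConj φ (-ζ - dot4 l (G u)) ∂μ) - ζ - dot4 l P ≤ δ') :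
    ∃ x, IsDensity φ μ x ∧ ∫ u, x u ∂μ = 1 ∧ (∃ c ∈ coneC, moment μ G x + c = P) ∧
      ∫ u, φ (x u) ∂μ < δ := by
  obtain ⟨r, hr1, hr2⟩ := exists_between hδ
  by_contra! hcon
  set A : Set (ℝ × ℝ × Vec4 d1 d2 d3 d4) := {z | ∃ x, IsDensity φ μ x ∧ ∃ c ∈ coneC,
    ∫ u, φ (x u) ∂μ ≤ z.1 ∧ z.2 = (∫ u, x u ∂μ, moment μ G x + c)} with hA
  have hconv : Convex ℝ A := by
    rintro ⟨v, w⟩ ⟨x, hx, c, hc, hv, hw⟩ ⟨v', w'⟩ ⟨y, hy, c', hc', hv', hw'⟩ a b ha hb hab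
    obtain ⟨hd, hle⟩ := hx.convexCombination h hy ha hb hab
    refine ⟨_, hd, a • c + b • c', add_mem_coneC (smul_mem_coneC hc ha) (smul_mem_coneC hc' hb),
      hle.trans (add_le_add (mul_le_mul_of_nonneg_left hv ha)
        (mul_le_mul_of_nonneg_left hv' hb)), ?_⟩
    simp only at hw hw'
    have h1 := hx.integral_combination h hy (OrliczHeart.const 1) a b
    simp only [mul_one] at h1
    rw [h1, moment_combination h hG hx hy]
    subst hw hw'
    refine Prod.ext (by simp) ?_
    simp only [Prod.snd_add, Prod.smul_snd, smul_add]
    abel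
  have hmem : ∀ x, IsDensity φ μ x → ∀ c ∈ coneC,
      (∫ u, φ (x u) ∂μ, ∫ u, x u ∂μ, moment μ G x + c) ∈ A :=
    fun x hx c hc => ⟨x, hx, c, hc, le_rfl, rfl⟩
  obtain ⟨f, hf⟩ := exists_multiplier (r := r) (w₀ := (1, P)) hconv
    ⟨_, hmem _ (IsDensity.const zero_le_one) 0 zero_mem_coneC⟩
    (fun v w s ⟨x, hx, c, hc, hv, hw⟩ hs => ⟨x, hx, c, hc, hv.trans (by simpa using hs), hw⟩)
    (fun ⟨x, hx, c, hc, hv, hw⟩ => by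
      simp only [Prod.mk.injEq] at hw
      have := hcon x hx hw.1.symm ⟨c, hc, hw.2.symm⟩
      simp only at hv
      linarith)
    (fun f hf => linearMap_eq_zero_of_interior_attainable hP f fun x hx c hc =>
      hf _ _ (hmem x hx c hc))
  obtain ⟨l, hl⟩ := exists_dot4 (f ∘ₗ LinearMap.inr ℝ ℝ _)
  set ζ := f (1, 0)
  have hdecomp : ∀ m p, f (m, p) = m * ζ + dot4 l p := fun m p => by
    have : (m, p) = m • ((1 : ℝ), (0 : Vec4 d1 d2 d3 d4)) + (0, p) := by simp
    rw [this, map_add, map_smul, smul_eq_mul, ← hl]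
    rfl
  have hineq : ∀ x, IsDensity φ μ x → ∀ c ∈ coneC, r + (ζ + dot4 l P) ≤
      ∫ u, φ (x u) ∂μ + ((∫ u, x u ∂μ) * ζ + (dot4 l (moment μ G x) + dot4 l c)) :=
    fun x hx c hc => by
      simpa only [hdecomp, one_mul, dot4_add] using hf _ _ (hmem x hx c hc)
  have hlam : inLambda l := inLambda_of_dot4_nonneg fun c hc =>
    nonneg_of_forall_le_add_mul (C := r + (ζ + dot4 l P))
        (D := ∫ _, φ 1 ∂μ + ((∫ _, 1 ∂μ) * ζ + dot4 l (moment μ G fun _ => 1))) fun s hs => by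
      have := hineq _ (IsDensity.const zero_le_one) _ (smul_mem_coneC hc hs)
      rw [dot4_smul] at this
      linarith
  have hheart : OrliczHeart φ μ fun u => -ζ - dot4 l (G u) := by
    simpa only [sub_eq_add_neg] using (OrliczHeart.const (-ζ)).add h (hG.dot4 h l).neg
  have hconj := hheart.integral_conj_le h (R := -(r + (ζ + dot4 l P))) fun x hx => by
    have h1 := hineq x hx 0 zero_mem_coneC
    have h2 : dot4 l (0 : Vec4 d1 d2 d3 d4) = 0 := by simpa using dot4_smul l 0 0
    have e : ∀ u, x u * (-ζ - dot4 l (G u)) - φ (x u)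
        = -(x u * ζ + x u * dot4 l (G u) + φ (x u)) := fun u => by ring
    simp only [e]
    rw [integral_neg, integral_add
      (((hx.integrable h).mul_const ζ).fun_add (hx.integrable_mul h (hG.dot4 h l)))
      hx.integrable_cost, integral_add ((hx.integrable h).mul_const ζ)
      (hx.integrable_mul h (hG.dot4 h l)), integral_mul_const, hx.integral_mul_dot4 h hG]
    linarith
  linarith [hdual ζ l hlam]

/-- Existence of near-optimal multipliers with a positive multiplier on the divergence. -/
theorem exists_dual_multipliers (h : RegularCost φ) (hG : OrliczHeartVec φ μ G)
    (hK : OrliczHeart φ μ K) {P : Vec4 d1 d2 d3 d4} (hP : P ∈ interior (attainable φ μ G))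
    {δ : ℝ} (hδ : 0 < δ)
    (hslater : ∃ x, IsDensity φ μ x ∧ ∫ u, x u ∂μ = 1 ∧ (∃ c ∈ coneC, moment μ G x + c = P) ∧
      ∫ u, φ (x u) ∂μ < δ)
    {r : ℝ} (hr : ∀ x, IsDensity φ μ x → ∫ u, x u ∂μ = 1 → (∃ c ∈ coneC, moment μ G x + c = P) →
      ∫ u, φ (x u) ∂μ ≤ δ → r < ∫ u, x u * K u ∂μ) {ε : ℝ} (hε : 0 < ε) :
    ∃ η, 0 < η ∧ ∃ ζ l, inLambda l ∧
      Integrable (fun u => η * costConj φ ((-(K u) - ζ - dot4 l (G u)) / η)) μ ∧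
      r - ε ≤ -(∫ u, η * costConj φ ((-(K u) - ζ - dot4 l (G u)) / η) ∂μ) - η * δ - ζ
        - dot4 l P := by
  set A : Set (ℝ × ℝ × ℝ × Vec4 d1 d2 d3 d4) := {z | ∃ x, IsDensity φ μ x ∧ ∃ c ∈ coneC,
    ∫ u, x u * K u ∂μ ≤ z.1 ∧ ∫ u, φ (x u) ∂μ ≤ z.2.1 ∧
      z.2.2 = (∫ u, x u ∂μ, moment μ G x + c)} with hA
  have hconv : Convex ℝ A := by
    rintro ⟨v, d, w⟩ ⟨x, hx, c, hc, hv, hd, hw⟩ ⟨v', d', w'⟩ ⟨y, hy, c', hc', hv', hd', hw'⟩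
      a b ha hb hab
    obtain ⟨hden, hle⟩ := hx.convexCombination h hy ha hb hab
    refine ⟨_, hden, a • c + b • c', add_mem_coneC (smul_mem_coneC hc ha) (smul_mem_coneC hc' hb),
      ?_, hle.trans (add_le_add (mul_le_mul_of_nonneg_left hd ha)
        (mul_le_mul_of_nonneg_left hd' hb)), ?_⟩
    · rw [hx.integral_combination h hy hK]
      exact add_le_add (mul_le_mul_of_nonneg_left hv ha) (mul_le_mul_of_nonneg_left hv' hb)
    simp only at hw hw'
    have h1 := hx.integral_combination h hy (OrliczHeart.const 1) a b
    simp only [mul_one] at h1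
    rw [h1, moment_combination h hG hx hy]
    subst hw hw'
    refine Prod.ext (by simp) ?_
    simp only [Prod.snd_add, Prod.smul_snd, smul_add]
    abel
  have hmem : ∀ x, IsDensity φ μ x → ∀ c ∈ coneC, ∀ s, 0 ≤ s →
      (∫ u, x u * K u ∂μ, ∫ u, φ (x u) ∂μ + s, ∫ u, x u ∂μ, moment μ G x + c) ∈ A :=
    fun x hx c hc s hs => ⟨x, hx, c, hc, le_rfl, by simpa using hs, rfl⟩
  have hdecomp₁ : ∀ (f : ℝ × ℝ × Vec4 d1 d2 d3 d4 →ₗ[ℝ] ℝ) d w,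
      f (d, w) = d * f (1, 0) + f (0, w) := fun f d w => by
    have : (d, w) = d • ((1 : ℝ), (0 : ℝ × Vec4 d1 d2 d3 d4)) + (0, w) := by simp
    rw [this, map_add, map_smul, smul_eq_mul]
  obtain ⟨x₀, hx₀, hx₀1, ⟨c₀, hc₀, hc₀P⟩, hx₀δ⟩ := hslater
  obtain ⟨f, hf⟩ := exists_multiplier (r := r) (w₀ := (δ, 1, P)) hconv
    ⟨_, hmem _ (IsDensity.const zero_le_one) 0 zero_mem_coneC 0 le_rfl⟩
    (fun v w s ⟨x, hx, c, hc, hv, hw⟩ hs => ⟨x, hx, c, hc, hv.trans (by simpa using hs), hw⟩)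
    (fun ⟨x, hx, c, hc, hv, hd, hw⟩ => by
      simp only [Prod.mk.injEq] at hw
      have := hr x hx hw.1.symm ⟨c, hc, hw.2.symm⟩ hd
      simp only at hv
      linarith)
    (fun f hf => by
      have h1 := hf _ _ (hmem x₀ hx₀ c₀ hc₀ 0 le_rfl)
      have h2 := hf _ _ (hmem x₀ hx₀ c₀ hc₀ (δ - ∫ u, φ (x₀ u) ∂μ + 1) (by linarith))
      rw [hx₀1, hc₀P, hdecomp₁ f δ, hdecomp₁ f (_ + _)] at h1 h2
      have hz : f (1, 0) = 0 := by nlinarith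
      have hi : f ∘ₗ LinearMap.inr ℝ ℝ _ = 0 :=
        linearMap_eq_zero_of_interior_attainable hP _ fun x hx c hc => by
          have := hf _ _ (hmem x hx c hc 0 le_rfl)
          rw [hdecomp₁ f δ, hdecomp₁ f (_ + _), hz] at this
          simpa using this
      refine LinearMap.ext fun ⟨d, w⟩ => ?_
      rw [hdecomp₁ f, hz, show f (0, w) = 0 from LinearMap.congr_fun hi w]
      simp)
  obtain ⟨l, hl⟩ := exists_dot4 (f ∘ₗ LinearMap.inr ℝ ℝ _ ∘ₗ LinearMap.inr ℝ ℝ _)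
  set η₀ := f (1, 0)
  set ζ := f (0, 1, 0)
  have hdecomp : ∀ d m p, f (d, m, p) = d * η₀ + (m * ζ + dot4 l p) := fun d m p => by
    have : (d, m, p) = d • ((1 : ℝ), (0 : ℝ × Vec4 d1 d2 d3 d4))
      + (m • ((0 : ℝ), (1 : ℝ), (0 : Vec4 d1 d2 d3 d4)) + (0, 0, p)) := by simp
    rw [this, map_add, map_add, map_smul, map_smul, smul_eq_mul, smul_eq_mul, ← hl]
    rfl
  have hineq : ∀ x, IsDensity φ μ x → ∀ c ∈ coneC, ∀ s, 0 ≤ s →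
      r + (δ * η₀ + (ζ + dot4 l P)) ≤ ∫ u, x u * K u ∂μ + ((∫ u, φ (x u) ∂μ + s) * η₀
        + ((∫ u, x u ∂μ) * ζ + (dot4 l (moment μ G x) + dot4 l c))) :=
    fun x hx c hc s hs => by
      simpa only [hdecomp, one_mul, dot4_add] using hf _ _ (hmem x hx c hc s hs)
  have hlam : inLambda l := inLambda_of_dot4_nonneg fun c hc =>
    nonneg_of_forall_le_add_mul (C := r + (δ * η₀ + (ζ + dot4 l P)))
        (D := ∫ u, 1 * K u ∂μ + ((∫ _, φ 1 ∂μ + 0) * η₀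
          + ((∫ _, 1 ∂μ) * ζ + dot4 l (moment μ G fun _ => 1)))) fun s hs => by
      have := hineq _ (IsDensity.const zero_le_one) _ (smul_mem_coneC hc hs) 0 le_rfl
      rw [dot4_smul] at this
      linarith
  have hη₀ : 0 ≤ η₀ := nonneg_of_forall_le_add_mul (C := r + (δ * η₀ + (ζ + dot4 l P)))
      (D := ∫ u, x₀ u * K u ∂μ + ((∫ u, φ (x₀ u) ∂μ) * η₀ + ((∫ u, x₀ u ∂μ) * ζ
        + (dot4 l (moment μ G x₀) + dot4 l (0 : Vec4 d1 d2 d3 d4))))) fun s hs => by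
    have := hineq x₀ hx₀ 0 zero_mem_coneC s hs
    rw [add_mul] at this
    linarith
  have hη : 0 < η₀ + ε / δ := add_pos_of_nonneg_of_pos hη₀ (div_pos hε hδ)
  set η := η₀ + ε / δ with hηdef
  have hδη : δ * η = δ * η₀ + ε := by rw [hηdef]; field_simp
  have hheart : OrliczHeart φ μ fun u => (-(K u) - ζ - dot4 l (G u)) / η := by
    have := (((hK.neg).add h (OrliczHeart.const (-ζ))).add h (hG.dot4 h l).neg).const_mul η⁻¹
    simpa only [sub_eq_add_neg, div_eq_inv_mul] using this
  refine ⟨η, hη, ζ, l, hlam, (hheart.integrable_conj h).const_mul η, ?_⟩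
  have hconj := hheart.integral_conj_le h (R := -((r - ε) + δ * η + ζ + dot4 l P) / η)
    fun x hx => by
      have h1 := hineq x hx 0 zero_mem_coneC 0 le_rfl
      have h2 : dot4 l (0 : Vec4 d1 d2 d3 d4) = 0 := by simpa using dot4_smul l 0 0
      have e : ∀ u, x u * ((-(K u) - ζ - dot4 l (G u)) / η) - φ (x u)
          = -(x u * K u + x u * ζ + x u * dot4 l (G u) + η * φ (x u)) / η := fun u => by
        field_simp
        ring
      simp only [e]
      have i1 := hx.integrable_mul h hK
      have i2 := (hx.integrable h).mul_const ζ
      have i3 := hx.integrable_mul h (hG.dot4 h l)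
      rw [integral_div, integral_neg, integral_add ((i1.fun_add i2).fun_add i3)
        (hx.integrable_cost.const_mul η), integral_add (i1.fun_add i2) i3, integral_add i1 i2,
        integral_mul_const, integral_const_mul, hx.integral_mul_dot4 h hG]
      refine div_le_div_of_nonneg_right ?_ hη.le
      have h3 : 0 ≤ ε / δ * ∫ u, φ (x u) ∂μ :=
        mul_nonneg (div_pos hε hδ).le (integral_nonneg fun u => h.nonneg _ (hx.nonneg u))
      have h4 : η * ∫ u, φ (x u) ∂μ
          = (∫ u, φ (x u) ∂μ) * η₀ + ε / δ * ∫ u, φ (x u) ∂μ := by rw [hηdef]; ring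
      simp only [add_zero] at h1
      linarith
  rw [le_div_iff₀ hη] at hconj
  rw [integral_const_mul]
  linarith

end Duality

section Densities

variable {φ : ℝ → ℝ} {U : Type*} [MeasurableSpace U] {μ : Measure U} [IsProbabilityMeasure μ]

/-- A probability density of finite cost induces a probability measure of the same divergence. -/
theorem IsDensity.exists_measure (h : RegularCost φ) {x : U → ℝ} (hx : IsDensity φ μ x)
    (hx1 : ∫ u, x u ∂μ = 1) :
    ∃ F : Measure U, IsProbabilityMeasure F ∧ Dphi φ μ F = ENNReal.ofReal (∫ u, φ (x u) ∂μ) ∧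
      ∀ f, OrliczHeart φ μ f → Integrable f F ∧ ∫ u, f u ∂F = ∫ u, x u * f u ∂μ := by
  have hm : Measurable fun u => ENNReal.ofReal (x u) := hx.measurable.ennreal_ofReal
  have hlt : ∀ᵐ u ∂μ, ENNReal.ofReal (x u) < ⊤ := .of_forall fun _ => ENNReal.ofReal_lt_top
  have hr : ∀ u, (ENNReal.ofReal (x u)).toReal = x u := fun u => ENNReal.toReal_ofReal (hx.nonneg u)
  refine ⟨μ.withDensity fun u => ENNReal.ofReal (x u), ⟨?_⟩, ?_, fun f hf => ⟨?_, ?_⟩⟩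
  · rw [withDensity_apply _ .univ, Measure.restrict_univ,
      ← ofReal_integral_eq_lintegral_ofReal (hx.integrable h) (.of_forall hx.nonneg), hx1,
      ENNReal.ofReal_one]
  · rw [Dphi, if_pos (withDensity_absolutelyContinuous _ _), ofReal_integral_eq_lintegral_ofReal
      hx.integrable_cost (.of_forall fun u => h.nonneg _ (hx.nonneg u))]
    refine lintegral_congr_ae ?_
    filter_upwards [μ.rnDeriv_withDensity hm] with u hu
    rw [hu, hr]
  · rw [integrable_withDensity_iff_integrable_smul' hm hlt]
    simpa only [hr, smul_eq_mul] using hx.integrable_mul h hf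
  · rw [integral_withDensity_eq_integral_toReal_smul hm hlt]
    simp only [hr, smul_eq_mul]

omit [IsProbabilityMeasure μ] in
/-- A probability measure of finite divergence has a density of the same cost. -/
theorem exists_isDensity [SigmaFinite μ] (h : RegularCost φ) {F : Measure U}
    [IsProbabilityMeasure F] (hF : Dphi φ μ F < ⊤) :
    ∃ x, IsDensity φ μ x ∧ ∫ u, x u ∂μ = 1 ∧
      Dphi φ μ F = ENNReal.ofReal (∫ u, φ (x u) ∂μ) ∧
      ∀ f : U → ℝ, ∫ u, f u ∂F = ∫ u, x u * f u ∂μ := by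
  have hac : F ≪ μ := by
    by_contra hac
    simp [Dphi, hac] at hF
  rw [Dphi, if_pos hac] at hF ⊢
  have hm : Measurable fun u => (F.rnDeriv μ u).toReal :=
    (Measure.measurable_rnDeriv F μ).ennreal_toReal
  have hnn : ∀ u, 0 ≤ φ (F.rnDeriv μ u).toReal := fun u => h.nonneg _ ENNReal.toReal_nonneg
  have hint : Integrable (fun u => φ (F.rnDeriv μ u).toReal) μ :=
    ⟨(h.measurable_comp hm fun _ => ENNReal.toReal_nonneg).aestronglyMeasurable,
      (hasFiniteIntegral_iff_ofReal (.of_forall hnn)).2 hF⟩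
  have hf : ∀ f : U → ℝ, ∫ u, f u ∂F = ∫ u, (F.rnDeriv μ u).toReal * f u ∂μ := fun f =>
    (integral_rnDeriv_smul hac).symm
  exact ⟨_, ⟨hm, fun _ => ENNReal.toReal_nonneg, hint⟩, by simpa using (hf fun _ => 1).symm,
    (ofReal_integral_eq_lintegral_ofReal hint (.of_forall hnn)).symm, hf⟩

end Densities

section Programs

variable {φ : ℝ → ℝ} {U : Type*} [MeasurableSpace U] {μ : Measure U} [IsProbabilityMeasure μ]
  {dθ d1 d2 d3 d4 : ℕ} {Γ : Type*} {g : U → (Fin dθ → ℝ) → Γ → Vec4 d1 d2 d3 d4}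
  {θ : Fin dθ → ℝ} {γ : Γ} {P : Vec12 d1 d2} {K : U → ℝ} {δ : ℝ}

theorem dot4_target (l : Vec4 d1 d2 d3 d4) (P : Vec12 d1 d2) :
    dot4 l (P.1, P.2, 0, 0) = dotP l P := by
  simp [dot4, dotP, dot]

omit [IsProbabilityMeasure μ] in
theorem constraintsHold_of_moment (hG : OrliczHeartVec φ μ fun u => g u θ γ) {x : U → ℝ}
    {F : Measure U}
    (hF : ∀ f, OrliczHeart φ μ f → Integrable f F ∧ ∫ u, f u ∂F = ∫ u, x u * f u ∂μ)
    (hc : ∃ c ∈ coneC, moment μ (fun u => g u θ γ) x + c = (P.1, P.2, 0, 0)) :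
    ConstraintsHold g θ γ P F := by
  obtain ⟨c, ⟨hc1, hc2, hc3, hc4⟩, he⟩ := hc
  simp only [moment, Prod.ext_iff, Prod.fst_add, Prod.snd_add, hc2, hc4, add_zero,
    funext_iff, Pi.add_apply, Pi.zero_apply] at he
  obtain ⟨e1, e2, e3, e4⟩ := he
  refine ⟨⟨fun i => (hF _ (hG.1 i)).1, fun i => (hF _ (hG.2.1 i)).1,
    fun i => (hF _ (hG.2.2.1 i)).1, fun i => (hF _ (hG.2.2.2 i)).1⟩,
    fun i => ?_, fun i => ?_, fun i => ?_, fun i => ?_⟩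
  · rw [(hF _ (hG.1 i)).2]
    linarith [e1 i, hc1 i]
  · rw [(hF _ (hG.2.1 i)).2, e2 i]
  · rw [(hF _ (hG.2.2.1 i)).2]
    linarith [e3 i, hc3 i]
  · rw [(hF _ (hG.2.2.2 i)).2, e4 i]

omit [IsProbabilityMeasure μ] in
theorem exists_moment_of_constraintsHold {x : U → ℝ} {F : Measure U}
    (hF : ∀ f : U → ℝ, ∫ u, f u ∂F = ∫ u, x u * f u ∂μ) (hc : ConstraintsHold g θ γ P F) :
    ∃ c ∈ coneC, moment μ (fun u => g u θ γ) x + c = (P.1, P.2, 0, 0) := by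
  obtain ⟨-, h1, h2, h3, h4⟩ := hc
  simp only [hF] at h1 h2 h3 h4
  refine ⟨(fun i => P.1 i - ∫ u, x u * (g u θ γ).1 i ∂μ, 0,
    fun i => 0 - ∫ u, x u * (g u θ γ).2.2.1 i ∂μ, 0),
    ⟨fun i => sub_nonneg.2 (h1 i), rfl, fun i => sub_nonneg.2 (h3 i), rfl⟩, ?_⟩
  refine Prod.ext (funext fun i => ?_) (Prod.ext (funext fun i => ?_)
    (Prod.ext (funext fun i => ?_) (funext fun i => ?_)))
  · simp [moment]
  · simpa [moment] using h2 i
  · simp [moment]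
  · simpa [moment] using h4 i

theorem mem_interior_attainable_of_conditionS (h : RegularCost φ) (hS : ConditionS φ μ g θ γ P) :
    ((P.1, P.2, 0, 0) : Vec4 d1 d2 d3 d4) ∈ interior (attainable φ μ fun u => g u θ γ) := by
  refine interior_mono ?_ hS
  rintro _ ⟨v, ⟨F, hFp, hF, -, rfl⟩, c, hc, rfl⟩
  obtain ⟨x, hx, hx1, -, hf⟩ := exists_isDensity h hF
  refine ⟨x, hx, hx1, c, hc, ?_⟩
  simp only [moment, hf]

/-- Weak duality for the lower program. -/
theorem dual_le_primal (h : RegularCost φ) (hG : OrliczHeartVec φ μ fun u => g u θ γ)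
    (hK : OrliczHeart φ μ K) (hδ : 0 < δ) {F : Measure U} (hF : Feasible φ μ g δ θ γ P F)
    {η ζ : ℝ} (hη : 0 ≤ η) {l : Vec4 d1 d2 d3 d4} (hl : inLambda l) {w : U → ℝ}
    (hw : Integrable w μ)
    (hwe : ∀ᵐ u ∂μ, (w u : EReal) = etaPhiStar φ η (-(K u) - ζ - dot4 l (g u θ γ))) :
    -(∫ u, w u ∂μ) - η * δ - ζ - dotP l P ≤ ∫ u, K u ∂F := by
  obtain ⟨hFp, hFδ, hFc⟩ := hF
  obtain ⟨x, hx, hx1, hD, hf⟩ := exists_isDensity h (hFδ.trans_lt ENNReal.ofReal_lt_top)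
  obtain ⟨c, hc, hcP⟩ := exists_moment_of_constraintsHold hf hFc
  have hcost : ∫ u, φ (x u) ∂μ ≤ δ := by
    rw [hD] at hFδ
    exact (ENNReal.ofReal_le_ofReal_iff hδ.le).1 hFδ
  have i1 := hx.integrable_mul h hK
  have i2 := (hx.integrable h).mul_const ζ
  have i3 := hx.integrable_mul h (hG.dot4 h l)
  have i4 := hx.integrable_cost.const_mul η
  have hle : ∫ u, -(x u * K u + x u * ζ + x u * dot4 l (g u θ γ) + η * φ (x u)) ∂μ
      ≤ ∫ u, w u ∂μ := by
    refine integral_mono_ae (((i1.fun_add i2).fun_add i3).fun_add i4).fun_neg hw ?_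
    filter_upwards [hwe] with u hu
    rw [← EReal.coe_le_coe_iff, hu]
    refine le_trans (EReal.coe_le_coe_iff.2 (le_of_eq ?_))
      (le_iSup₂ (f := fun (t : ℝ) (_ : t ∈ Ici (0 : ℝ)) =>
        ((t * (-(K u) - ζ - dot4 l (g u θ γ)) - η * φ t : ℝ) : EReal)) (x u) (hx.nonneg u))
    ring
  rw [integral_neg, integral_add ((i1.fun_add i2).fun_add i3) i4,
    integral_add (i1.fun_add i2) i3, integral_add i1 i2, integral_mul_const, integral_const_mul,
    hx.integral_mul_dot4 h hG, hx1] at hle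
  have h1 : dot4 l (moment μ (fun u => g u θ γ) x) + dot4 l c = dotP l P := by
    rw [← dot4_add, hcP, dot4_target]
  rw [hf]
  linarith [dot4_nonneg hl hc, mul_le_mul_of_nonneg_left hcost hη]

/-- Near-attainment of any strict lower bound on the primal value by the dual program. -/
theorem exists_dual_ge (h : RegularCost φ) (hG : OrliczHeartVec φ μ fun u => g u θ γ)
    (hK : OrliczHeart φ μ K) (hδ : 0 < δ) (hS : ConditionS φ μ g θ γ P)
    (hδs : deltaStar φ μ g θ γ P < (δ : EReal)) {r : ℝ}
    (hr : ∀ F, Feasible φ μ g δ θ γ P F → Integrable K F → r < ∫ u, K u ∂F)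
    {ε : ℝ} (hε : 0 < ε) :
    ∃ η, 0 < η ∧ ∃ ζ l, inLambda l ∧ ∃ w : U → ℝ, Integrable w μ ∧
      (∀ᵐ u ∂μ, (w u : EReal) = etaPhiStar φ η (-(K u) - ζ - dot4 l (g u θ γ))) ∧
      r - ε ≤ -(∫ u, w u ∂μ) - η * δ - ζ - dotP l P := by
  have hP := mem_interior_attainable_of_conditionS h hS
  obtain ⟨δ', hδ1, hδ2⟩ := EReal.lt_iff_exists_real_btwn.1 hδs
  have hslater := exists_slater_density h hG hP (EReal.coe_lt_coe_iff.1 hδ2) fun ζ l hl => by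
    refine EReal.coe_le_coe_iff.1 (le_trans (le_sSup ?_) hδ1.le)
    have hheart : OrliczHeart φ μ fun u => -ζ - dot4 l (g u θ γ) := by
      simpa only [sub_eq_add_neg] using (OrliczHeart.const (-ζ)).add h (hG.dot4 h l).neg
    exact ⟨ζ, l, hl, _, hheart.integrable_conj h, .of_forall fun u => h.coe_conj _,
      by rw [dot4_target]⟩
  obtain ⟨η, hη, ζ, l, hl, hint, hle⟩ := exists_dual_multipliers h hG hK hP hδ hslater (r := r)
    (fun x hx hx1 hc hcost => by
      obtain ⟨F, hFp, hD, hf⟩ := hx.exists_measure h hx1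
      have := hr F ⟨hFp, hD.trans_le (ENNReal.ofReal_le_ofReal hcost),
        constraintsHold_of_moment hG hf hc⟩ (hf K hK).1
      rwa [(hf K hK).2] at this) hε
  rw [dot4_target] at hle
  exact ⟨η, hη, ζ, l, hl, _, hint, .of_forall fun u => (h.etaPhiStar_eq hη _).symm, hle⟩

end Programs

section Values

variable {φ : ℝ → ℝ} {U : Type*} [MeasurableSpace U] {μ : Measure U} [IsProbabilityMeasure μ]
  {dθ d1 d2 d3 d4 : ℕ} {Γ : Type*} {g : U → (Fin dθ → ℝ) → Γ → Vec4 d1 d2 d3 d4}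
  {k : U → (Fin dθ → ℝ) → Γ → ℝ} {θ : Fin dθ → ℝ} {γ : Γ} {P : Vec12 d1 d2} {δ : ℝ}

omit [IsProbabilityMeasure μ] in
theorem kappaLowDualPos_le : kappaLowDualPos φ μ g k δ θ γ P ≤ kappaLowDual φ μ g k δ θ γ P :=
  sSup_le_sSup fun _ ⟨η, hη, hx⟩ => ⟨η, hη.le, hx⟩

omit [IsProbabilityMeasure μ] in
theorem le_kappaHighDualPos : kappaHighDual φ μ g k δ θ γ P ≤ kappaHighDualPos φ μ g k δ θ γ P :=
  sInf_le_sInf fun _ ⟨η, hη, hx⟩ => ⟨η, hη.le, hx⟩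

theorem kappaLowDual_le (h : RegularCost φ) (hG : OrliczHeartVec φ μ fun u => g u θ γ)
    (hK : OrliczHeart φ μ fun u => k u θ γ) (hδ : 0 < δ) :
    kappaLowDual φ μ g k δ θ γ P ≤ kappaLow φ μ g k δ θ γ P := by
  refine sSup_le fun _ ⟨η, hη, ζ, l, hl, w, hw, hwe, hx⟩ => le_sInf fun _ ⟨F, hF, _, hy⟩ => ?_
  rw [hx, hy, EReal.coe_le_coe_iff]
  exact dual_le_primal h hG hK hδ hF hη hl hw hwe

theorem le_kappaHighDual (h : RegularCost φ) (hG : OrliczHeartVec φ μ fun u => g u θ γ)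
    (hK : OrliczHeart φ μ fun u => k u θ γ) (hδ : 0 < δ) :
    kappaHigh φ μ g k δ θ γ P ≤ kappaHighDual φ μ g k δ θ γ P := by
  refine sSup_le fun _ ⟨F, hF, _, hy⟩ => le_sInf fun _ ⟨η, hη, ζ, l, hl, w, hw, hwe, hx⟩ => ?_
  rw [hx, hy, EReal.coe_le_coe_iff]
  have := dual_le_primal (ζ := ζ) h hG hK.neg hδ hF hη hl hw (by simpa only [neg_neg] using hwe)
  rw [integral_neg] at this
  linarith

theorem kappaLow_le (h : RegularCost φ) (hG : OrliczHeartVec φ μ fun u => g u θ γ)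
    (hK : OrliczHeart φ μ fun u => k u θ γ) (hδ : 0 < δ) (hS : ConditionS φ μ g θ γ P)
    (hδs : deltaStar φ μ g θ γ P < (δ : EReal)) :
    kappaLow φ μ g k δ θ γ P ≤ kappaLowDualPos φ μ g k δ θ γ P := by
  refine le_of_forall_lt fun a ha => ?_
  obtain ⟨s, has, hs⟩ := EReal.lt_iff_exists_real_btwn.1 ha
  obtain ⟨r, hsr, hr⟩ := EReal.lt_iff_exists_real_btwn.1 hs
  obtain ⟨η, hη, ζ, l, hl, w, hw, hwe, hle⟩ := exists_dual_ge h hG hK hδ hS hδs (r := r)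
    (fun F hF hint => EReal.coe_lt_coe_iff.1 (hr.trans_le (sInf_le ⟨F, hF, hint, rfl⟩)))
    (sub_pos.2 (EReal.coe_lt_coe_iff.1 hsr))
  rw [sub_sub_cancel] at hle
  exact has.trans_le ((EReal.coe_le_coe_iff.2 hle).trans
    (le_sSup ⟨η, hη, ζ, l, hl, w, hw, hwe, rfl⟩))

theorem kappaHighDualPos_le (h : RegularCost φ) (hG : OrliczHeartVec φ μ fun u => g u θ γ)
    (hK : OrliczHeart φ μ fun u => k u θ γ) (hδ : 0 < δ) (hS : ConditionS φ μ g θ γ P)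
    (hδs : deltaStar φ μ g θ γ P < (δ : EReal)) :
    kappaHighDualPos φ μ g k δ θ γ P ≤ kappaHigh φ μ g k δ θ γ P := by
  refine le_of_forall_gt fun a ha => ?_
  obtain ⟨s, hs, hsa⟩ := EReal.lt_iff_exists_real_btwn.1 ha
  obtain ⟨r, hr, hrs⟩ := EReal.lt_iff_exists_real_btwn.1 hs
  obtain ⟨η, hη, ζ, l, hl, w, hw, hwe, hle⟩ := exists_dual_ge h hG hK.neg hδ hS hδs (r := -r)
    (fun F hF hint => by
      rw [integral_neg, neg_lt_neg_iff]
      refine EReal.coe_lt_coe_iff.1 (lt_of_le_of_lt (le_sSup ?_) hr)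
      exact ⟨F, hF, by simpa using hint.fun_neg, rfl⟩)
    (sub_pos.2 (EReal.coe_lt_coe_iff.1 hrs))
  simp only [neg_neg] at hwe
  refine lt_of_le_of_lt (sInf_le ⟨η, hη, ζ, l, hl, w, hw, hwe, rfl⟩)
    ((EReal.coe_le_coe_iff.2 ?_).trans_lt hsa)
  linarith

end Values

/-- **Strong duality for extreme counterfactuals; Lemmas 1 and 2(ii).**
Under Assumptions Φ(i) and Φ(ii), if Condition S holds at `(θ,γ,P)` and `δ*(θ;γ,P) < δ`,
then `κ̲_δ = κ̲*_δ` and `κ̄_δ = κ̄*_δ` at `(θ,γ,P)`, and moreover the supremum (resp.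
infimum) defining `κ̲*_δ` (resp. `κ̄*_δ`) is unchanged when taken over
`(η,ζ,λ) ∈ (0,∞)×ℝ×Λ` instead of `[0,∞)×ℝ×Λ`. -/
theorem strong_duality_extreme_counterfactuals
    {U : Type*} [MeasurableSpace U] {dθ d1 d2 d3 d4 : ℕ} {Γ : Type*}
    (φ : ℝ → ℝ) (Fstar : Measure U) [IsProbabilityMeasure Fstar]
    (g : U → (Fin dθ → ℝ) → Γ → Vec4 d1 d2 d3 d4)
    (k : U → (Fin dθ → ℝ) → Γ → ℝ)
    (Θ : Set (Fin dθ → ℝ))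
    (hΦ1 : PhiOne φ)
    (hΦ2 : PhiTwo φ Fstar g k)
    (δ : ℝ) (hδ : 0 < δ)
    (θ : Fin dθ → ℝ) (hθ : θ ∈ Θ) (γ : Γ) (P : Vec12 d1 d2)
    (hS : ConditionS φ Fstar g θ γ P)
    (hδs : deltaStar φ Fstar g θ γ P < ((δ : ℝ) : EReal)) :
    kappaLow φ Fstar g k δ θ γ P = kappaLowDual φ Fstar g k δ θ γ P ∧
    kappaHigh φ Fstar g k δ θ γ P = kappaHighDual φ Fstar g k δ θ γ P ∧
    kappaLowDual φ Fstar g k δ θ γ P = kappaLowDualPos φ Fstar g k δ θ γ P ∧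
    kappaHighDual φ Fstar g k δ θ γ P = kappaHighDualPos φ Fstar g k δ θ γ P := by
  have h := regularCost_of_phiOne hΦ1
  obtain ⟨hk, h1, h2, h3, h4⟩ := hΦ2 θ γ
  have hK := OrliczHeart.of_memE h hk
  have hG : OrliczHeartVec φ Fstar fun u => g u θ γ :=
    ⟨fun i => .of_memE h (h1 i), fun i => .of_memE h (h2 i), fun i => .of_memE h (h3 i),
      fun i => .of_memE h (h4 i)⟩
  have low1 := kappaLowDual_le (P := P) h hG hK hδ
  have low2 := kappaLow_le h hG hK hδ hS hδs
  have low3 := kappaLowDualPos_le (φ := φ) (μ := Fstar) (g := g) (k := k) (θ := θ) (γ := γ)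
    (P := P) (δ := δ)
  have high1 := le_kappaHighDual (P := P) h hG hK hδ
  have high2 := kappaHighDualPos_le h hG hK hδ hS hδs
  have high3 := le_kappaHighDualPos (φ := φ) (μ := Fstar) (g := g) (k := k) (θ := θ) (γ := γ)
    (P := P) (δ := δ)
  exact ⟨le_antisymm (low2.trans low3) low1, le_antisymm high1 (high3.trans high2),
    le_antisymm (low1.trans low2) low3, le_antisymm high3 (high2.trans high1)⟩
end
end

section
/- Dual programs for Kullback–Leibler neighborhoods: let φ(x) = x log x − x + 1, so that D_φ is Kullback–Leibler divergence and ℰ = {f : E^{F*}[e^{c|f(U)|}] < ∞ for all c > 0}. Under Assumption Φ(ii) for this φ, if Condition S holds at (θ,γ,P) and δ*(θ;γ,P) < δ, then κ̲_δ(θ;γ,P) = sup_{η>0, λ∈Λ} ( −η log E^{F*}[exp(−η^{−1}(k(U,θ,γ) + λ'g(U,θ,γ)))] − ηδ − λ12'P ) and κ̄_δ(θ;γ,P) = inf_{η>0, λ∈Λ} ( η log E^{F*}[exp(η^{−1}(k(U,θ,γ) − λ'g(U,θ,γ)))] + ηδ + λ12'P ); moreover δ*(θ;γ,P) = sup_{λ∈Λ}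 ( −log E^{F*}[exp(−λ'g(U,θ,γ))] − λ12'P ). -/
open MeasureTheory Filter Set
open scoped ENNReal Pointwise Classical

noncomputable section

namespace CFSens

/-- The Kullback–Leibler cost `φ(x) = x log x - x + 1` (on `[0,∞)`; `Real.log 0 = 0`
gives the correct value `φ(0) = 1` by continuity). -/
def klPhi : ℝ → ℝ := fun x => x * Real.log x - x + 1

variable {U : Type*} [MeasurableSpace U] {dθ d1 d2 d3 d4 : ℕ} {Γ : Type*}

/-- Exponential Orlicz heart for KL: `E^{F*}[e^{c|f|}] < ∞` for all `c > 0`. -/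
def MemExpE (Fstar : Measure U) (f : U → ℝ) : Prop :=
  Measurable f ∧ ∀ c : ℝ, 0 < c → Integrable (fun u => Real.exp (c * |f u|)) Fstar

/-- The KL lower dual program
`sup_{η>0,λ∈Λ} ( -η log E^{F*}[exp(-η⁻¹(k + λ'g))] - ηδ - λ12'P )`. -/
def klLowDual (Fstar : Measure U) (g : U → (Fin dθ → ℝ) → Γ → Vec4 d1 d2 d3 d4)
    (k : U → (Fin dθ → ℝ) → Γ → ℝ) (δ : ℝ) (θ : Fin dθ → ℝ) (γ : Γ)
    (P : Vec12 d1 d2) : EReal :=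
  sSup {x : EReal | ∃ η : ℝ, 0 < η ∧ ∃ l : Vec4 d1 d2 d3 d4, inLambda l ∧
    Integrable (fun u => Real.exp (-(k u θ γ + dot4 l (g u θ γ)) / η)) Fstar ∧
    x = ((-η * Real.log (∫ u, Real.exp (-(k u θ γ + dot4 l (g u θ γ)) / η) ∂Fstar)
          - η * δ - dotP l P : ℝ) : EReal)}

/-- The KL upper dual program
`inf_{η>0,λ∈Λ} ( η log E^{F*}[exp(η⁻¹(k - λ'g))] + ηδ + λ12'P )`. -/
def klHighDual (Fstar : Measure U) (g : U → (Fin dθ → ℝ) → Γ → Vec4 d1 d2 d3 d4)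
    (k : U → (Fin dθ → ℝ) → Γ → ℝ) (δ : ℝ) (θ : Fin dθ → ℝ) (γ : Γ)
    (P : Vec12 d1 d2) : EReal :=
  sInf {x : EReal | ∃ η : ℝ, 0 < η ∧ ∃ l : Vec4 d1 d2 d3 d4, inLambda l ∧
    Integrable (fun u => Real.exp ((k u θ γ - dot4 l (g u θ γ)) / η)) Fstar ∧
    x = ((η * Real.log (∫ u, Real.exp ((k u θ γ - dot4 l (g u θ γ)) / η) ∂Fstar)
          + η * δ + dotP l P : ℝ) : EReal)}

/-- The KL program `sup_{λ∈Λ} ( -log E^{F*}[exp(-λ'g)] - λ12'P )`. -/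
def klDeltaStar (Fstar : Measure U) (g : U → (Fin dθ → ℝ) → Γ → Vec4 d1 d2 d3 d4)
    (θ : Fin dθ → ℝ) (γ : Γ) (P : Vec12 d1 d2) : EReal :=
  sSup {x : EReal | ∃ l : Vec4 d1 d2 d3 d4, inLambda l ∧
    Integrable (fun u => Real.exp (-(dot4 l (g u θ γ)))) Fstar ∧
    x = ((-Real.log (∫ u, Real.exp (-(dot4 l (g u θ γ))) ∂Fstar) - dotP l P : ℝ) : EReal)}

end CFSens

namespace CFSens

open InformationTheory

section Multipliers

variable {d1 d2 d3 d4 : ℕ}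

lemma dot4_add_right (l v w : Vec4 d1 d2 d3 d4) : dot4 l (v + w) = dot4 l v + dot4 l w := by
  simp only [dot4, dot, Prod.fst_add, Prod.snd_add, Pi.add_apply, mul_add, Finset.sum_add_distrib]
  ring

lemma dot4_smul_right (c : ℝ) (l v : Vec4 d1 d2 d3 d4) : dot4 l (c • v) = c * dot4 l v := by
  simp only [dot4, dot, Prod.smul_fst, Prod.smul_snd, Pi.smul_apply, smul_eq_mul, mul_add,
    Finset.mul_sum, mul_left_comm]

lemma dot4_smul_left (c : ℝ) (l v : Vec4 d1 d2 d3 d4) : dot4 (c • l) v = c * dot4 l v := by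
  simp only [dot4, dot, Prod.smul_fst, Prod.smul_snd, Pi.smul_apply, smul_eq_mul, mul_add,
    Finset.mul_sum, mul_assoc]

lemma dotP_smul_left (c : ℝ) (l : Vec4 d1 d2 d3 d4) (P : Vec12 d1 d2) :
    dotP (c • l) P = c * dotP l P := by
  simp only [dotP, dot, Prod.smul_fst, Prod.smul_snd, Pi.smul_apply, smul_eq_mul, mul_add,
    Finset.mul_sum, mul_assoc]

lemma dot4_target (l : Vec4 d1 d2 d3 d4) (P : Vec12 d1 d2) :
    dot4 l (P.1, P.2, 0, 0) = dotP l P := by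
  simp [dot4, dotP, dot]

lemma inLambda.smul {l : Vec4 d1 d2 d3 d4} (hl : inLambda l) {c : ℝ} (hc : 0 ≤ c) :
    inLambda (c • l) :=
  ⟨fun i => mul_nonneg hc (hl.1 i), fun i => mul_nonneg hc (hl.2 i)⟩

lemma dot_self_nonneg {ι : Type*} [Fintype ι] (v : ι → ℝ) : 0 ≤ dot v v :=
  Finset.sum_nonneg fun _ _ => mul_self_nonneg _

lemma dot_self_eq_zero {ι : Type*} [Fintype ι] {v : ι → ℝ} (h : dot v v ≤ 0) : v = 0 := by
  have hs : dot v v = 0 := le_antisymm h (dot_self_nonneg v)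
  funext i
  exact mul_self_eq_zero.mp
    ((Finset.sum_eq_zero_iff_of_nonneg fun _ _ => mul_self_nonneg _).mp hs i (Finset.mem_univ i))

lemma eq_zero_of_dot4_self_nonpos {l : Vec4 d1 d2 d3 d4} (h : dot4 l l ≤ 0) : l = 0 := by
  have h1 := dot_self_nonneg l.1
  have h2 := dot_self_nonneg l.2.1
  have h3 := dot_self_nonneg l.2.2.1
  have h4 := dot_self_nonneg l.2.2.2
  simp only [dot4] at h
  exact Prod.ext (dot_self_eq_zero (by linarith)) (Prod.ext (dot_self_eq_zero (by linarith))
    (Prod.ext (dot_self_eq_zero (by linarith)) (dot_self_eq_zero (by linarith))))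

/-- A linear functional on `ℝ^ι` is a dot product. -/
lemma exists_dot_eq {ι : Type*} [Fintype ι] (f : (ι → ℝ) →ₗ[ℝ] ℝ) :
    ∃ l : ι → ℝ, ∀ v, f v = dot l v :=
  ⟨fun i => f (Pi.single i 1), fun v => by
    rw [f.pi_apply_eq_sum_univ v, dot]
    refine Finset.sum_congr rfl fun i _ => ?_
    rw [smul_eq_mul, mul_comm]
    congr 2
    funext j
    simp [Pi.single_apply, eq_comm]⟩

/-- A linear functional on the space of stacked vectors is given by a vector of multipliers. -/
lemma exists_dot4_eq (f : Vec4 d1 d2 d3 d4 →ₗ[ℝ] ℝ) :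
    ∃ l : Vec4 d1 d2 d3 d4, ∀ v, f v = dot4 l v := by
  obtain ⟨l1, h1⟩ := exists_dot_eq (f ∘ₗ LinearMap.inl ℝ _ _)
  obtain ⟨l2, h2⟩ := exists_dot_eq (f ∘ₗ LinearMap.inr ℝ _ _ ∘ₗ LinearMap.inl ℝ _ _)
  obtain ⟨l3, h3⟩ :=
    exists_dot_eq (f ∘ₗ LinearMap.inr ℝ _ _ ∘ₗ LinearMap.inr ℝ _ _ ∘ₗ LinearMap.inl ℝ _ _)
  obtain ⟨l4, h4⟩ :=
    exists_dot_eq (f ∘ₗ LinearMap.inr ℝ _ _ ∘ₗ LinearMap.inr ℝ _ _ ∘ₗ LinearMap.inr ℝ _ _)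
  refine ⟨(l1, l2, l3, l4), fun v => ?_⟩
  obtain ⟨v1, v2, v3, v4⟩ := v
  simp only [dot4, ← h1, ← h2, ← h3, ← h4, LinearMap.comp_apply, LinearMap.inl_apply,
    LinearMap.inr_apply, ← map_add, Prod.mk_add_mk, add_zero, zero_add]

end Multipliers

section Separation

/-- In finite dimension, a point outside a nonempty convex set (with no topological assumption)
can be weakly separated from it by a nonzero functional. -/
lemma exists_ne_zero_forall_le_of_notMem {E : Type*} [NormedAddCommGroup E] [NormedSpace ℝ E]
    [FiniteDimensional ℝ E] {A : Set E} (hA : Convex ℝ A) (hne : A.Nonempty) {x : E}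
    (hx : x ∉ A) : ∃ f : E →ₗ[ℝ] ℝ, f ≠ 0 ∧ ∀ y ∈ A, f x ≤ f y := by
  by_cases hint : (interior A).Nonempty
  · obtain ⟨f, hf0, hf⟩ := geometric_hahn_banach_of_nonempty_interior_point hA
      (fun h => hx (interior_subset h)) hint
    refine ⟨-(f : E →ₗ[ℝ] ℝ), neg_ne_zero.mpr fun h => hf0 ?_, fun y hy => ?_⟩
    · exact ContinuousLinearMap.coe_injective h
    · simpa using hf y hy
  · obtain ⟨a, ha⟩ := hne
    have hspan : affineSpan ℝ A ≠ ⊤ := fun h =>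
      hint (hA.interior_nonempty_iff_affineSpan_eq_top.mpr h)
    have hdir : vectorSpan ℝ A ≠ ⊤ := fun h => hspan
      ((AffineSubspace.affineSpan_eq_top_iff_vectorSpan_eq_top_of_nonempty ℝ E E ⟨a, ha⟩).mpr h)
    obtain ⟨f, hf0, hf⟩ := Submodule.exists_le_ker_of_lt_top _ (lt_top_iff_ne_top.mpr hdir)
    have hconst : ∀ y ∈ A, f y = f a := fun y hy => by
      have := hf (vsub_mem_vectorSpan ℝ hy ha)
      rw [LinearMap.mem_ker, vsub_eq_sub, map_sub] at this
      linarith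
    rcases le_total (f x) (f a) with h | h
    · exact ⟨f, hf0, fun y hy => (hconst y hy).symm ▸ h⟩
    · refine ⟨-f, neg_ne_zero.mpr hf0, fun y hy => ?_⟩
      simp only [LinearMap.neg_apply, hconst y hy]
      linarith

end Separation

section ExponentialMoments

variable {U : Type*} [MeasurableSpace U] {μ : Measure U} {f h : U → ℝ}

lemma MemExpE.add (hf : MemExpE μ f) (hh : MemExpE μ h) : MemExpE μ (fun u => f u + h u) := by
  refine ⟨hf.1.add hh.1, fun c hc => ?_⟩
  have hfm := hf.1
  have hhm := hh.1
  refine Integrable.mono' ((hf.2 (2 * c) (by positivity)).add (hh.2 (2 * c) (by positivity)))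
    (by fun_prop) (ae_of_all _ fun u => ?_)
  rw [Real.norm_eq_abs, abs_of_pos (Real.exp_pos _)]
  have h1 : Real.exp (2 * c * |f u|) = Real.exp (c * |f u|) ^ 2 := by
    rw [← Real.exp_nat_mul]; congr 1; push_cast; ring
  have h2 : Real.exp (2 * c * |h u|) = Real.exp (c * |h u|) ^ 2 := by
    rw [← Real.exp_nat_mul]; congr 1; push_cast; ring
  calc Real.exp (c * |f u + h u|) ≤ Real.exp (c * |f u| + c * |h u|) := by
        rw [← mul_add]; gcongr; exact abs_add_le _ _
    _ = Real.exp (c * |f u|) * Real.exp (c * |h u|) := Real.exp_add _ _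
    _ ≤ _ := by
        simp only [Pi.add_apply, h1, h2]
        nlinarith [sq_nonneg (Real.exp (c * |f u|) - Real.exp (c * |h u|)),
          sq_nonneg (Real.exp (c * |f u|)), sq_nonneg (Real.exp (c * |h u|))]

lemma memExpE_zero [IsFiniteMeasure μ] : MemExpE μ (fun _ => 0) :=
  ⟨measurable_const, fun c _ => by simp⟩

lemma MemExpE.const_mul [IsFiniteMeasure μ] (hf : MemExpE μ f) (a : ℝ) :
    MemExpE μ (fun u => a * f u) := by
  rcases eq_or_ne a 0 with rfl | ha
  · simpa using memExpE_zero
  · refine ⟨hf.1.const_mul a, fun c hc => ?_⟩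
    simpa only [abs_mul, mul_assoc] using hf.2 (c * |a|) (by positivity)

lemma MemExpE.neg [IsFiniteMeasure μ] (hf : MemExpE μ f) : MemExpE μ (fun u => -f u) := by
  simpa using hf.const_mul (-1)

lemma MemExpE.div_const [IsFiniteMeasure μ] (hf : MemExpE μ f) (a : ℝ) :
    MemExpE μ (fun u => f u / a) := by
  simpa only [div_eq_inv_mul] using hf.const_mul a⁻¹

lemma memExpE_dot [IsFiniteMeasure μ] {ι : Type*} [Fintype ι] {G : U → ι → ℝ}
    (hG : ∀ i, MemExpE μ (fun u => G u i)) (l : ι → ℝ) : MemExpE μ (fun u => dot l (G u)) := by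
  suffices ∀ s : Finset ι, MemExpE μ (fun u => ∑ i ∈ s, l i * G u i) from this Finset.univ
  intro s
  induction s using Finset.induction_on with
  | empty => simpa using memExpE_zero
  | insert i s hi ih => simpa only [Finset.sum_insert hi] using ((hG i).const_mul (l i)).add ih

lemma MemExpE.integrable_exp (hf : MemExpE μ f) : Integrable (fun u => Real.exp (f u)) μ := by
  have hm := hf.1
  refine Integrable.mono' (hf.2 1 one_pos) (by fun_prop) (ae_of_all _ fun u => ?_)
  rw [Real.norm_eq_abs, abs_of_pos (Real.exp_pos _), one_mul]
  exact Real.exp_le_exp.mpr (le_abs_self _)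

end ExponentialMoments

section Entropy

variable {U : Type*} [MeasurableSpace U] {μ F : Measure U} {h : U → ℝ}

lemma klPhi_eq_klFun (t : ℝ) : klPhi t = klFun t := by
  rw [klPhi, klFun_apply]; ring

/-- The Fenchel–Young inequality for `t log t - t + 1`. -/
lemma mul_le_klFun_add_exp {t : ℝ} (ht : 0 ≤ t) (x : ℝ) :
    t * x ≤ klFun t + (Real.exp x - 1) := by
  rcases ht.eq_or_lt with rfl | ht
  · rw [klFun_zero]
    linarith [Real.exp_pos x]
  · have h1 := mul_le_mul_of_nonneg_left (Real.add_one_le_exp (x - Real.log t)) ht.le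
    have h2 : t * Real.exp (x - Real.log t) = Real.exp x := by
      rw [Real.exp_sub, Real.exp_log ht]; field_simp
    rw [klFun_apply]
    linarith

lemma phiStar_klPhi (x : ℝ) : phiStar klPhi x = ((Real.exp x - 1 : ℝ) : EReal) := by
  refine le_antisymm (iSup₂_le fun t ht => ?_) ?_
  · rw [EReal.coe_le_coe_iff, klPhi_eq_klFun]
    linarith [mul_le_klFun_add_exp ht x]
  · refine le_iSup₂_of_le (Real.exp x) (Real.exp_pos x).le ?_
    rw [EReal.coe_le_coe_iff, klPhi, Real.log_exp]
    linarith

lemma Dphi_klPhi (μ F : Measure U) [IsFiniteMeasure μ] [IsFiniteMeasure F] :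
    Dphi klPhi μ F = klDiv F μ := by
  simp only [Dphi, klDiv_eq_lintegral_klFun, klPhi_eq_klFun]

/-- Functions with all exponential moments are integrable under measures of finite divergence. -/
lemma MemExpE.integrable_of_klDiv_ne_top [IsFiniteMeasure μ] [IsFiniteMeasure F]
    (hh : MemExpE μ h) (hF : klDiv F μ ≠ ∞) : Integrable h F := by
  obtain ⟨hac, hllr⟩ := klDiv_ne_top_iff.mp hF
  have hm := hh.1
  rw [← integrable_rnDeriv_smul_iff hac]
  have hexp := hh.2 1 one_pos
  refine Integrable.mono'
    (((integrable_klFun_rnDeriv_iff hac).mpr hllr).add (hexp.sub (integrable_const 1)))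
    (by fun_prop) (ae_of_all _ fun u => ?_)
  rw [norm_smul, Real.norm_eq_abs, Real.norm_eq_abs, abs_of_nonneg ENNReal.toReal_nonneg]
  simpa using mul_le_klFun_add_exp (ENNReal.toReal_nonneg (a := F.rnDeriv μ u)) |h u|

/-- The Donsker–Varadhan inequality. -/
lemma MemExpE.integral_le_klDiv_add_log [IsProbabilityMeasure μ] [IsProbabilityMeasure F]
    (hh : MemExpE μ h) (hF : klDiv F μ ≠ ∞) :
    ∫ u, h u ∂F ≤ (klDiv F μ).toReal + Real.log (∫ u, Real.exp (h u) ∂μ) := by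
  obtain ⟨hac, hllr⟩ := klDiv_ne_top_iff.mp hF
  have hint := hh.integrable_of_klDiv_ne_top hF
  have hexp := hh.integrable_exp
  have := isProbabilityMeasure_tilted hexp
  have hnonneg := integral_llr_add_sub_measure_univ_nonneg
    (hac.trans (absolutelyContinuous_tilted hexp)) (integrable_llr_tilted_right hac hint hllr hexp)
  rw [integral_llr_tilted_right hac hint hexp hllr] at hnonneg
  rw [toReal_klDiv_of_measure_eq hac (by simp)]
  simp only [probReal_univ] at hnonneg
  linarith

lemma MemExpE.integrable_tilted [IsProbabilityMeasure μ] (hh : MemExpE μ h) :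
    Integrable h (μ.tilted h) := by
  have hm := hh.1
  rw [integrable_tilted_iff hh.integrable_exp]
  refine Integrable.mono' (hh.2 2 two_pos) (by fun_prop) (ae_of_all _ fun u => ?_)
  rw [norm_smul, Real.norm_eq_abs, Real.norm_eq_abs, abs_of_pos (Real.exp_pos _), two_mul,
    Real.exp_add]
  gcongr
  · exact le_abs_self _
  · linarith [Real.add_one_le_exp |h u|]

lemma llr_tilted_self [IsProbabilityMeasure μ] (hh : MemExpE μ h) :
    llr (μ.tilted h) μ =ᵐ[μ.tilted h] fun u => h u - Real.log (∫ u, Real.exp (h u) ∂μ) :=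
  (tilted_absolutelyContinuous μ h).ae_le (log_rnDeriv_tilted_left_self hh.integrable_exp)

lemma MemExpE.klDiv_tilted_ne_top [IsProbabilityMeasure μ] (hh : MemExpE μ h) :
    klDiv (μ.tilted h) μ ≠ ∞ := by
  refine klDiv_ne_top (tilted_absolutelyContinuous μ h) ?_
  rw [integrable_congr (llr_tilted_self hh)]
  exact hh.integrable_tilted.sub (integrable_const _)

lemma MemExpE.toReal_klDiv_tilted [IsProbabilityMeasure μ] (hh : MemExpE μ h) :
    (klDiv (μ.tilted h) μ).toReal =
      ∫ u, h u ∂(μ.tilted h) - Real.log (∫ u, Real.exp (h u) ∂μ) := by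
  have := isProbabilityMeasure_tilted hh.integrable_exp
  rw [toReal_klDiv_of_measure_eq (tilted_absolutelyContinuous μ h) (by simp),
    integral_congr_ae (llr_tilted_self hh),
    integral_sub hh.integrable_tilted (integrable_const _)]
  simp

/-- Optimality of the Gibbs measure: a lower bound on the entropy-penalized expectation is a
lower bound on the corresponding free energy. -/
lemma le_neg_mul_log_of_forall_le [IsProbabilityMeasure μ] (hh : MemExpE μ h) {η c : ℝ}
    (hη : 0 < η)
    (hc : ∀ F : Measure U, IsProbabilityMeasure F → klDiv F μ ≠ ∞ →
      c ≤ ∫ u, h u ∂F + η * (klDiv F μ).toReal) :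
    c ≤ -η * Real.log (∫ u, Real.exp (-h u / η) ∂μ) := by
  have hh' : MemExpE μ (fun u => -h u / η) := hh.neg.div_const η
  have := hc _ (isProbabilityMeasure_tilted hh'.integrable_exp) hh'.klDiv_tilted_ne_top
  rw [hh'.toReal_klDiv_tilted, integral_div, integral_neg, mul_sub, mul_div_cancel₀ _ hη.ne']
    at this
  linarith

lemma klDiv_convexComb_le [IsFiniteMeasure μ] {F₁ F₂ : Measure U} [IsFiniteMeasure F₁]
    [IsFiniteMeasure F₂] (h₁ : klDiv F₁ μ ≠ ∞) (h₂ : klDiv F₂ μ ≠ ∞) {a b : NNReal}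
    (hab : a + b = 1) :
    klDiv (a • F₁ + b • F₂) μ ≤ a * klDiv F₁ μ + b * klDiv F₂ μ := by
  obtain ⟨hac₁, -⟩ := klDiv_ne_top_iff.mp h₁
  obtain ⟨hac₂, -⟩ := klDiv_ne_top_iff.mp h₂
  have hac : a • F₁ + b • F₂ ≪ μ :=
    Measure.AbsolutelyContinuous.add_left (hac₁.smul_left a) (hac₂.smul_left b)
  rw [klDiv_eq_lintegral_klFun_of_ac hac, klDiv_eq_lintegral_klFun_of_ac hac₁,
    klDiv_eq_lintegral_klFun_of_ac hac₂, ← lintegral_const_mul _ (by fun_prop),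
    ← lintegral_const_mul _ (by fun_prop), ← lintegral_add_left (by fun_prop)]
  refine lintegral_mono_ae ?_
  filter_upwards [Measure.rnDeriv_add (a • F₁) (b • F₂) μ, Measure.rnDeriv_smul_left F₁ μ a,
    Measure.rnDeriv_smul_left F₂ μ b, F₁.rnDeriv_lt_top μ, F₂.rnDeriv_lt_top μ]
    with u hu hu₁ hu₂ ht₁ ht₂
  have hval : ((a • F₁ + b • F₂).rnDeriv μ u).toReal =
      (a : ℝ) • (F₁.rnDeriv μ u).toReal + (b : ℝ) • (F₂.rnDeriv μ u).toReal := by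
    rw [hu, Pi.add_apply, hu₁, hu₂, Pi.smul_apply, Pi.smul_apply, ENNReal.smul_def,
      ENNReal.smul_def, smul_eq_mul, smul_eq_mul,
      ENNReal.toReal_add (ENNReal.mul_ne_top ENNReal.coe_ne_top ht₁.ne)
        (ENNReal.mul_ne_top ENNReal.coe_ne_top ht₂.ne)]
    simp
  have hconv := convexOn_klFun.2 (ENNReal.toReal_nonneg (a := F₁.rnDeriv μ u))
    (ENNReal.toReal_nonneg (a := F₂.rnDeriv μ u)) a.coe_nonneg b.coe_nonneg
    (by exact_mod_cast hab)
  rw [hval]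
  refine (ENNReal.ofReal_le_ofReal hconv).trans ?_
  rw [smul_eq_mul, smul_eq_mul, ENNReal.ofReal_add
    (mul_nonneg a.coe_nonneg (klFun_nonneg ENNReal.toReal_nonneg))
    (mul_nonneg b.coe_nonneg (klFun_nonneg ENNReal.toReal_nonneg)),
    ENNReal.ofReal_mul a.coe_nonneg, ENNReal.ofReal_mul b.coe_nonneg, ENNReal.ofReal_coe_nnreal,
    ENNReal.ofReal_coe_nnreal]

end Entropy

section Duality

variable {U : Type*} [MeasurableSpace U] {d1 d2 d3 d4 : ℕ} {μ F : Measure U} {K : U → ℝ}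
  {G : U → Vec4 d1 d2 d3 d4} {P : Vec12 d1 d2} {δ : ℝ}

/-- All components of `G` have exponential moments of every order. -/
def MemExpE4 (μ : Measure U) (G : U → Vec4 d1 d2 d3 d4) : Prop :=
  (∀ i, MemExpE μ (fun u => (G u).1 i)) ∧ (∀ i, MemExpE μ (fun u => (G u).2.1 i)) ∧
  (∀ i, MemExpE μ (fun u => (G u).2.2.1 i)) ∧ (∀ i, MemExpE μ (fun u => (G u).2.2.2 i))

/-- The vector of moments of `G` under `F`. -/
def moments (G : U → Vec4 d1 d2 d3 d4) (F : Measure U) : Vec4 d1 d2 d3 d4 :=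
  ((fun i => ∫ u, (G u).1 i ∂F), (fun i => ∫ u, (G u).2.1 i ∂F),
    (fun i => ∫ u, (G u).2.2.1 i ∂F), (fun i => ∫ u, (G u).2.2.2 i ∂F))

lemma MemExpE4.dot4 [IsFiniteMeasure μ] (hG : MemExpE4 μ G) (l : Vec4 d1 d2 d3 d4) :
    MemExpE μ (fun u => dot4 l (G u)) :=
  (((memExpE_dot hG.1 l.1).add (memExpE_dot hG.2.1 l.2.1)).add
    (memExpE_dot hG.2.2.1 l.2.2.1)).add (memExpE_dot hG.2.2.2 l.2.2.2)

lemma integral_dot {ι : Type*} [Fintype ι] {H : U → ι → ℝ}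
    (hH : ∀ i, Integrable (fun u => H u i) F) (l : ι → ℝ) :
    Integrable (fun u => dot l (H u)) F ∧
      ∫ u, dot l (H u) ∂F = dot l (fun i => ∫ u, H u i ∂F) := by
  have h : ∀ i ∈ Finset.univ, Integrable (fun u => l i * H u i) F :=
    fun i _ => (hH i).const_mul (l i)
  refine ⟨integrable_finsetSum _ h, ?_⟩
  simp only [dot]
  rw [integral_finsetSum _ h]
  simp only [integral_const_mul]

lemma integral_dot4 [IsFiniteMeasure μ] [IsFiniteMeasure F] (hG : MemExpE4 μ G)
    (hF : klDiv F μ ≠ ∞) (l : Vec4 d1 d2 d3 d4) :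
    ∫ u, dot4 l (G u) ∂F = dot4 l (moments G F) := by
  obtain ⟨i1, e1⟩ := integral_dot (fun i => (hG.1 i).integrable_of_klDiv_ne_top hF) l.1
  obtain ⟨i2, e2⟩ := integral_dot (fun i => (hG.2.1 i).integrable_of_klDiv_ne_top hF) l.2.1
  obtain ⟨i3, e3⟩ := integral_dot (fun i => (hG.2.2.1 i).integrable_of_klDiv_ne_top hF) l.2.2.1
  obtain ⟨i4, e4⟩ := integral_dot (fun i => (hG.2.2.2 i).integrable_of_klDiv_ne_top hF) l.2.2.2
  simp only [CFSens.dot4, moments, ← e1, ← e2, ← e3, ← e4]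
  have i12 : Integrable (fun u => dot l.1 (G u).1 + dot l.2.1 (G u).2.1) F := i1.add i2
  have i123 : Integrable
      (fun u => dot l.1 (G u).1 + dot l.2.1 (G u).2.1 + dot l.2.2.1 (G u).2.2.1) F := i12.add i3
  rw [integral_add i123 i4, integral_add i12 i3, integral_add i1 i2]

lemma integral_convexComb {F₁ F₂ : Measure U} {h : U → ℝ} (h₁ : Integrable h F₁)
    (h₂ : Integrable h F₂) (a b : NNReal) :
    ∫ u, h u ∂(a • F₁ + b • F₂) = a * ∫ u, h u ∂F₁ + b * ∫ u, h u ∂F₂ := by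
  rw [integral_add_measure h₁.smul_measure_nnreal h₂.smul_measure_nnreal,
    integral_smul_nnreal_measure, integral_smul_nnreal_measure]
  rfl

lemma moments_convexComb [IsFiniteMeasure μ] (hG : MemExpE4 μ G) {F₁ F₂ : Measure U}
    [IsFiniteMeasure F₁] [IsFiniteMeasure F₂] (h₁ : klDiv F₁ μ ≠ ∞) (h₂ : klDiv F₂ μ ≠ ∞)
    (a b : NNReal) :
    moments G (a • F₁ + b • F₂) = (a : ℝ) • moments G F₁ + (b : ℝ) • moments G F₂ := by
  have key : ∀ {h : U → ℝ}, MemExpE μ h →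
      ∫ u, h u ∂(a • F₁ + b • F₂) = a * ∫ u, h u ∂F₁ + b * ∫ u, h u ∂F₂ := fun hh =>
    integral_convexComb (hh.integrable_of_klDiv_ne_top h₁) (hh.integrable_of_klDiv_ne_top h₂) a b
  exact Prod.ext (funext fun i => key (hG.1 i)) (Prod.ext (funext fun i => key (hG.2.1 i))
    (Prod.ext (funext fun i => key (hG.2.2.1 i)) (funext fun i => key (hG.2.2.2 i))))

lemma convex_coneC : Convex ℝ (coneC : Set (Vec4 d1 d2 d3 d4)) := by
  rintro c ⟨h1, h2, h3, h4⟩ d ⟨k1, k2, k3, k4⟩ a b ha hb -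
  refine ⟨fun i => ?_, ?_, fun i => ?_, ?_⟩
  · exact add_nonneg (mul_nonneg ha (h1 i)) (mul_nonneg hb (k1 i))
  · simp [h2, k2]
  · exact add_nonneg (mul_nonneg ha (h3 i)) (mul_nonneg hb (k3 i))
  · simp [h4, k4]

/-- The upper set of attainable values of objective, divergence and moments. -/
def valueSet (μ : Measure U) (K : U → ℝ) (G : U → Vec4 d1 d2 d3 d4) :
    Set (ℝ × ℝ × Vec4 d1 d2 d3 d4) :=
  {y | ∃ F : Measure U, IsProbabilityMeasure F ∧ klDiv F μ ≠ ∞ ∧ ∫ u, K u ∂F ≤ y.1 ∧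
    (klDiv F μ).toReal ≤ y.2.1 ∧ ∃ c ∈ coneC, y.2.2 = moments G F + c}

lemma convex_valueSet [IsProbabilityMeasure μ] (hK : MemExpE μ K) (hG : MemExpE4 μ G) :
    Convex ℝ (valueSet μ K G) := by
  rintro y ⟨F₁, hp₁, h₁, hk₁, hd₁, c₁, hc₁, hv₁⟩ z ⟨F₂, hp₂, h₂, hk₂, hd₂, c₂, hc₂, hv₂⟩
    a b ha hb hab
  lift a to NNReal using ha
  lift b to NNReal using hb
  have hab' : a + b = 1 := by exact_mod_cast hab
  have hle := klDiv_convexComb_le h₁ h₂ hab'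
  have hne : (a : ℝ≥0∞) * klDiv F₁ μ + b * klDiv F₂ μ ≠ ∞ := ENNReal.add_ne_top.mpr
    ⟨ENNReal.mul_ne_top ENNReal.coe_ne_top h₁, ENNReal.mul_ne_top ENNReal.coe_ne_top h₂⟩
  refine ⟨a • F₁ + b • F₂, ⟨?_⟩, ne_top_of_le_ne_top hne hle, ?_, ?_,
    (a : ℝ) • c₁ + (b : ℝ) • c₂, convex_coneC hc₁ hc₂ a.coe_nonneg b.coe_nonneg hab, ?_⟩
  · simp only [Measure.coe_add, Pi.add_apply, Measure.smul_apply, measure_univ, ENNReal.smul_def,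
      smul_eq_mul, mul_one]
    exact_mod_cast hab'
  · rw [integral_convexComb (hK.integrable_of_klDiv_ne_top h₁) (hK.integrable_of_klDiv_ne_top h₂)]
    exact add_le_add (mul_le_mul_of_nonneg_left hk₁ a.coe_nonneg)
      (mul_le_mul_of_nonneg_left hk₂ b.coe_nonneg)
  · refine (ENNReal.toReal_mono hne hle).trans ?_
    rw [ENNReal.toReal_add (ENNReal.mul_ne_top ENNReal.coe_ne_top h₁)
      (ENNReal.mul_ne_top ENNReal.coe_ne_top h₂), ENNReal.toReal_mul, ENNReal.toReal_mul]
    exact add_le_add (mul_le_mul_of_nonneg_left hd₁ a.coe_nonneg)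
      (mul_le_mul_of_nonneg_left hd₂ b.coe_nonneg)
  · rw [moments_convexComb hG h₁ h₂]
    simp only [Prod.snd_add, Prod.smul_snd, hv₁, hv₂, smul_add]
    abel

lemma nonneg_of_forall_le_add_mul {x y a : ℝ} (h : ∀ t : ℝ, 0 ≤ t → x ≤ y + t * a) : 0 ≤ a := by
  by_contra! ha
  have h0 := h 0 le_rfl
  have := h ((y - x + 1) / -a) (div_nonneg (by linarith) (by linarith))
  rw [div_mul_eq_mul_div, div_neg, mul_div_cancel_right₀ _ ha.ne] at this
  linarith

/-- Free energy bound: a Lagrangian lower bound valid for all measures of finite divergence. -/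
lemma dual_value_of_forall_le [IsProbabilityMeasure μ] {h : U → ℝ} (hh : MemExpE μ h)
    (hG : MemExpE4 μ G) {η c : ℝ} (hη : 0 < η) (l : Vec4 d1 d2 d3 d4)
    (hc : ∀ F : Measure U, IsProbabilityMeasure F → klDiv F μ ≠ ∞ →
      c ≤ ∫ u, h u ∂F + η * (klDiv F μ).toReal + dot4 l (moments G F)) :
    c ≤ -η * Real.log (∫ u, Real.exp (-(h u + dot4 l (G u)) / η) ∂μ) := by
  refine le_neg_mul_log_of_forall_le (hh.add (hG.dot4 l)) hη fun F hp hF => ?_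
  rw [integral_add (hh.integrable_of_klDiv_ne_top hF) ((hG.dot4 l).integrable_of_klDiv_ne_top hF),
    integral_dot4 hG hF]
  linarith [hc F hp hF]

/-- Lagrange multipliers for a value `m` below the constrained infimum. -/
lemma exists_multipliers [IsProbabilityMeasure μ] (hK : MemExpE μ K) (hG : MemExpE4 μ G)
    (hS : ((P.1, P.2, 0, 0) : Vec4 d1 d2 d3 d4) ∈ interior
      ({v | ∃ F : Measure U, IsProbabilityMeasure F ∧ klDiv F μ ≠ ∞ ∧ v = moments G F} + coneC))
    (hδ : ∀ l : Vec4 d1 d2 d3 d4, inLambda l →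
      -Real.log (∫ u, Real.exp (-(dot4 l (G u))) ∂μ) - dotP l P < δ)
    {m : ℝ} (hm : (m, δ, ((P.1, P.2, 0, 0) : Vec4 d1 d2 d3 d4)) ∉ valueSet μ K G) :
    ∃ η : ℝ, 0 ≤ η ∧ ∃ l : Vec4 d1 d2 d3 d4, inLambda l ∧
      ∀ F : Measure U, IsProbabilityMeasure F → klDiv F μ ≠ ∞ →
        m + η * δ + dotP l P ≤ ∫ u, K u ∂F + η * (klDiv F μ).toReal + dot4 l (moments G F) := by
  have hmem : ∀ F : Measure U, IsProbabilityMeasure F → klDiv F μ ≠ ∞ →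
      ∀ s t : ℝ, 0 ≤ s → 0 ≤ t → ∀ c ∈ coneC,
      (∫ u, K u ∂F + s, (klDiv F μ).toReal + t, moments G F + c) ∈ valueSet μ K G :=
    fun F hp hF s t hs ht c hc =>
      ⟨F, hp, hF, le_add_of_nonneg_right hs, le_add_of_nonneg_right ht, c, hc, rfl⟩
  have hzero : (0 : Vec4 d1 d2 d3 d4) ∈ coneC := ⟨fun _ => le_rfl, rfl, fun _ => le_rfl, rfl⟩
  have hμ : klDiv μ μ ≠ ∞ := by simp
  obtain ⟨f, hf0, hf⟩ := exists_ne_zero_forall_le_of_notMem (convex_valueSet hK hG)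
    ⟨_, hmem μ inferInstance hμ 0 0 le_rfl le_rfl 0 hzero⟩ hm
  obtain ⟨l, hl⟩ := exists_dot4_eq (f ∘ₗ LinearMap.inr ℝ _ _ ∘ₗ LinearMap.inr ℝ _ _)
  set α := f (1, 0, 0) with hα
  set β := f (0, 1, 0) with hβ
  have hfval : ∀ a b v, f (a, b, v) = a * α + b * β + dot4 l v := fun a b v => by
    rw [← hl, hα, hβ, ← smul_eq_mul, ← smul_eq_mul, ← map_smul, ← map_smul]
    simp only [LinearMap.comp_apply, LinearMap.inr_apply, ← map_add]
    simp
  have hle : ∀ F : Measure U, IsProbabilityMeasure F → klDiv F μ ≠ ∞ →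
      ∀ s t : ℝ, 0 ≤ s → 0 ≤ t → ∀ c ∈ coneC, m * α + δ * β + dotP l P ≤
        (∫ u, K u ∂F + s) * α + ((klDiv F μ).toReal + t) * β + dot4 l (moments G F) + dot4 l c :=
    fun F hp hF s t hs ht c hc => by
      have := hf _ (hmem F hp hF s t hs ht c hc)
      rw [hfval, hfval, dot4_target, dot4_add_right] at this
      linarith
  have hαn : 0 ≤ α := nonneg_of_forall_le_add_mul (x := m * α + δ * β + dotP l P)
    (y := (∫ u, K u ∂μ) * α + (klDiv μ μ).toReal * β + dot4 l (moments G μ) + dot4 l 0) fun t ht => by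
      linarith [hle μ inferInstance hμ t 0 ht le_rfl 0 hzero]
  have hβn : 0 ≤ β := nonneg_of_forall_le_add_mul (x := m * α + δ * β + dotP l P)
    (y := (∫ u, K u ∂μ) * α + (klDiv μ μ).toReal * β + dot4 l (moments G μ) + dot4 l 0) fun t ht => by
      linarith [hle μ inferInstance hμ 0 t le_rfl ht 0 hzero]
  have hcone : ∀ c ∈ coneC, 0 ≤ dot4 l c := fun c hc =>
    nonneg_of_forall_le_add_mul fun t ht => by
      have := hle μ inferInstance hμ 0 0 le_rfl le_rfl (t • c)
        ⟨fun i => mul_nonneg ht (hc.1 i), by simp [hc.2.1],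
          fun i => mul_nonneg ht (hc.2.2.1 i), by simp [hc.2.2.2]⟩
      rw [dot4_smul_right] at this
      exact this
  have hlΛ : inLambda l := by
    constructor
    · intro i
      have := hcone (Pi.single i 1, 0, 0, 0)
        ⟨fun j => by by_cases h : j = i <;> simp [h], rfl, fun _ => le_rfl, rfl⟩
      simpa [dot4, dot, Pi.single_apply] using this
    · intro i
      have := hcone (0, 0, Pi.single i 1, 0)
        ⟨fun _ => le_rfl, rfl, fun j => by by_cases h : j = i <;> simp [h], rfl⟩
      simpa [dot4, dot, Pi.single_apply] using this
  have hbase : ∀ F : Measure U, IsProbabilityMeasure F → klDiv F μ ≠ ∞ →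
      m * α + δ * β + dotP l P ≤
        (∫ u, K u ∂F) * α + (klDiv F μ).toReal * β + dot4 l (moments G F) := fun F hp hF => by
    have := hle F hp hF 0 0 le_rfl le_rfl 0 hzero
    have h0 : dot4 l 0 = 0 := by simp [dot4, dot]
    simpa only [add_zero, h0] using this
  have hαpos : 0 < α := by
    refine hαn.lt_of_ne' fun hα0 => ?_
    rcases hβn.eq_or_lt with hβ0 | hβpos
    · have hl0 : l = 0 := by
        refine eq_zero_of_dot4_self_nonpos ?_
        have hcont : Filter.Tendsto
            (fun t : ℝ => ((P.1, P.2, 0, 0) : Vec4 d1 d2 d3 d4) + (-t) • l)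
            (nhdsWithin 0 (Set.Ioi 0)) (nhds (P.1, P.2, 0, 0)) := by
          have : Continuous
              (fun t : ℝ => ((P.1, P.2, 0, 0) : Vec4 d1 d2 d3 d4) + (-t) • l) := by fun_prop
          simpa using (this.tendsto 0).mono_left nhdsWithin_le_nhds
        obtain ⟨t, ht, htpos⟩ := ((hcont.eventually (mem_interior_iff_mem_nhds.mp hS)).and
          self_mem_nhdsWithin).exists
        obtain ⟨v, ⟨F, hp, hF, rfl⟩, c, hc, hvc⟩ := ht
        have h1 := hbase F hp hF
        have h2 := hcone c hc
        have h3 := congrArg (dot4 l) hvc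
        simp only [dot4_add_right, dot4_smul_right, dot4_target] at h3
        rw [hα0, ← hβ0] at h1
        have htpos' : 0 < t := htpos
        have : t * dot4 l l ≤ 0 := by linarith
        exact nonpos_of_mul_nonpos_right this htpos'
      refine hf0 (LinearMap.ext fun ⟨a, b, v⟩ => ?_)
      rw [hfval, hα0, ← hβ0, hl0]
      simp [dot4, dot]
    · have h1 := dual_value_of_forall_le (h := fun _ => 0) memExpE_zero hG hβpos l
        (c := δ * β + dotP l P) fun F hp hF => by
          have := hbase F hp hF
          rw [hα0] at this
          simp only [integral_zero]
          linarith
      have h2 := hδ (β⁻¹ • l) (hlΛ.smul (inv_nonneg.mpr hβn))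
      have h3 : ∀ u, -(0 + dot4 l (G u)) / β = -dot4 (β⁻¹ • l) (G u) := fun u => by
        rw [dot4_smul_left]; ring
      simp only [h3] at h1
      rw [dotP_smul_left] at h2
      have h4 := mul_lt_mul_of_pos_left h2 hβpos
      rw [mul_sub, mul_inv_cancel_left₀ hβpos.ne'] at h4
      linarith
  refine ⟨β / α, div_nonneg hβn hαn, α⁻¹ • l, hlΛ.smul (inv_nonneg.mpr hαn), fun F hp hF => ?_⟩
  have := mul_le_mul_of_nonneg_left (hbase F hp hF) (inv_nonneg.mpr hαn)
  rw [dotP_smul_left, dot4_smul_left]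
  field_simp at this ⊢
  linarith

end Duality

section Programs

variable {U : Type*} [MeasurableSpace U] {dθ d1 d2 d3 d4 : ℕ} {Γ : Type*} {μ : Measure U}
  {g : U → (Fin dθ → ℝ) → Γ → Vec4 d1 d2 d3 d4} {k : U → (Fin dθ → ℝ) → Γ → ℝ} {δ : ℝ}
  {θ : Fin dθ → ℝ} {γ : Γ} {P : Vec12 d1 d2}

lemma sSup_eq_neg_sInf {S T : Set EReal} (h : ∀ x, x ∈ S ↔ -x ∈ T) : sSup S = -sInf T := by
  refine le_antisymm (sSup_le fun x hx => ?_) ?_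
  · rw [EReal.le_neg]
    exact sInf_le ((h x).mp hx)
  · rw [EReal.neg_le]
    refine le_sInf fun x hx => ?_
    rw [EReal.neg_le]
    exact le_sSup ((h (-x)).mpr (by rwa [neg_neg]))

lemma kappaHigh_eq_neg_kappaLow (φ : ℝ → ℝ) :
    kappaHigh φ μ g k δ θ γ P = -kappaLow φ μ g (fun u θ γ => -k u θ γ) δ θ γ P := by
  refine sSup_eq_neg_sInf fun x => exists_congr fun F => and_congr_right fun _ =>
    and_congr integrable_neg_iff.symm ?_
  rw [integral_neg, EReal.coe_neg, neg_inj]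

lemma klHighDual_eq_neg_klLowDual :
    klHighDual μ g k δ θ γ P = -klLowDual μ g (fun u θ γ => -k u θ γ) δ θ γ P := by
  rw [eq_comm, neg_eq_iff_eq_neg]
  refine sSup_eq_neg_sInf fun x => exists_congr fun η => and_congr_right fun _ =>
    exists_congr fun l => and_congr_right fun _ => ?_
  have h : ∀ u, -(-k u θ γ + dot4 l (g u θ γ)) / η = (k u θ γ - dot4 l (g u θ γ)) / η :=
    fun u => by ring
  simp only [h]
  refine and_congr_right fun _ => ?_
  generalize Real.log (∫ u, Real.exp ((k u θ γ - dot4 l (g u θ γ)) / η) ∂μ) = L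
  rw [neg_eq_iff_eq_neg, ← EReal.coe_neg]
  ring_nf

/-- Profiling out the normalization multiplier. -/
lemma deltaStar_klPhi [IsProbabilityMeasure μ] (hG : MemExpE4 μ (fun u => g u θ γ))
    (P : Vec12 d1 d2) : deltaStar klPhi μ g θ γ P = klDeltaStar μ g θ γ P := by
  have hexp : ∀ l : Vec4 d1 d2 d3 d4, Integrable (fun u => Real.exp (-(dot4 l (g u θ γ)))) μ :=
    fun l => (hG.dot4 l).neg.integrable_exp
  have hsplit : ∀ (ζ : ℝ) (l : Vec4 d1 d2 d3 d4), Integrable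
      (fun u => Real.exp (-ζ - dot4 l (g u θ γ)) - 1) μ ∧
      ∫ u, (Real.exp (-ζ - dot4 l (g u θ γ)) - 1) ∂μ =
        Real.exp (-ζ) * ∫ u, Real.exp (-(dot4 l (g u θ γ))) ∂μ - 1 := fun ζ l => by
    simp only [sub_eq_add_neg (-ζ), Real.exp_add]
    have h := (hexp l).const_mul (Real.exp (-ζ))
    refine ⟨h.sub (integrable_const 1), ?_⟩
    rw [integral_sub h (integrable_const 1), integral_const_mul]
    simp
  refine le_antisymm (sSup_le ?_) (sSup_le ?_)
  · rintro x ⟨ζ, l, hl, w, hw, hwe, rfl⟩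
    refine le_sSup_of_le ⟨l, hl, hexp l, rfl⟩ (EReal.coe_le_coe_iff.mpr ?_)
    have hpos : 0 < ∫ u, Real.exp (-(dot4 l (g u θ γ))) ∂μ := integral_exp_pos (hexp l)
    have hwe' : w =ᵐ[μ] fun u => Real.exp (-ζ - dot4 l (g u θ γ)) - 1 := by
      filter_upwards [hwe] with u hu
      rwa [phiStar_klPhi, EReal.coe_eq_coe_iff] at hu
    rw [integral_congr_ae hwe', (hsplit ζ l).2]
    have h := Real.log_le_sub_one_of_pos (mul_pos (Real.exp_pos (-ζ)) hpos)
    rw [Real.log_mul (Real.exp_pos _).ne' hpos.ne', Real.log_exp] at h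
    linarith
  · rintro x ⟨l, hl, -, rfl⟩
    have hpos : 0 < ∫ u, Real.exp (-(dot4 l (g u θ γ))) ∂μ := integral_exp_pos (hexp l)
    refine le_sSup ⟨Real.log (∫ u, Real.exp (-(dot4 l (g u θ γ))) ∂μ), l, hl, _,
      (hsplit _ l).1, ae_of_all _ fun u => (phiStar_klPhi _).symm, ?_⟩
    rw [(hsplit _ l).2, Real.exp_neg, Real.exp_log hpos, inv_mul_cancel₀ hpos.ne']
    simp

lemma MemExpE4.gIntegrable [IsFiniteMeasure μ] {F : Measure U} [IsFiniteMeasure F]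
    (hG : MemExpE4 μ (fun u => g u θ γ)) (hF : klDiv F μ ≠ ∞) : GIntegrable g θ γ F :=
  ⟨fun i => (hG.1 i).integrable_of_klDiv_ne_top hF,
    fun i => (hG.2.1 i).integrable_of_klDiv_ne_top hF,
    fun i => (hG.2.2.1 i).integrable_of_klDiv_ne_top hF,
    fun i => (hG.2.2.2 i).integrable_of_klDiv_ne_top hF⟩

lemma dot_le_dot {ι : Type*} [Fintype ι] {l v w : ι → ℝ} (hl : ∀ i, 0 ≤ l i)
    (h : ∀ i, v i ≤ w i) : dot l v ≤ dot l w :=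
  Finset.sum_le_sum fun i _ => mul_le_mul_of_nonneg_left (h i) (hl i)

lemma ConstraintsHold.dot4_moments_le {F : Measure U} (h : ConstraintsHold g θ γ P F)
    {l : Vec4 d1 d2 d3 d4} (hl : inLambda l) :
    dot4 l (moments (fun u => g u θ γ) F) ≤ dotP l P := by
  obtain ⟨-, h1, h2, h3, h4⟩ := h
  rw [← dot4_target]
  exact add_le_add (add_le_add (add_le_add (dot_le_dot hl.1 h1)
    (congrArg (dot l.2.1) (funext h2)).le) (dot_le_dot hl.2 h3))
    (congrArg (dot l.2.2.2) (funext h4)).le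

lemma klLowDual_le_kappaLow [IsProbabilityMeasure μ] (hK : MemExpE μ (fun u => k u θ γ))
    (hG : MemExpE4 μ (fun u => g u θ γ)) (hδ : 0 < δ) :
    klLowDual μ g k δ θ γ P ≤ kappaLow klPhi μ g k δ θ γ P := by
  refine sSup_le ?_
  rintro x ⟨η, hη, l, hl, -, rfl⟩
  refine le_sInf ?_
  rintro y ⟨F, ⟨hp, hD, hC⟩, hint, rfl⟩
  rw [EReal.coe_le_coe_iff]
  rw [Dphi_klPhi] at hD
  have hF : klDiv F μ ≠ ∞ := ne_top_of_le_ne_top ENNReal.ofReal_ne_top hD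
  have hDr : (klDiv F μ).toReal ≤ δ := ENNReal.toReal_le_of_le_ofReal hδ.le hD
  have hl4 := hG.dot4 l
  have hDV := ((hK.add hl4).neg.div_const η).integral_le_klDiv_add_log hF
  rw [integral_div, integral_neg, integral_add hint (hl4.integrable_of_klDiv_ne_top hF),
    integral_dot4 hG hF, div_le_iff₀ hη] at hDV
  have h1 := hC.dot4_moments_le hl
  have h2 := mul_le_mul_of_nonneg_left hDr hη.le
  linarith

lemma kappaLow_le_klLowDual [IsProbabilityMeasure μ] (hK : MemExpE μ (fun u => k u θ γ))
    (hG : MemExpE4 μ (fun u => g u θ γ)) (hδ : 0 < δ)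
    (hS : ((P.1, P.2, 0, 0) : Vec4 d1 d2 d3 d4) ∈ interior
      ({v | ∃ F : Measure U, IsProbabilityMeasure F ∧ klDiv F μ ≠ ∞ ∧
        v = moments (fun u => g u θ γ) F} + coneC))
    (hlt : ∀ l : Vec4 d1 d2 d3 d4, inLambda l →
      -Real.log (∫ u, Real.exp (-(dot4 l (g u θ γ))) ∂μ) - dotP l P < δ) :
    kappaLow klPhi μ g k δ θ γ P ≤ klLowDual μ g k δ θ γ P := by
  refine EReal.ge_of_forall_gt_iff_ge.mp fun z hz => ?_
  obtain ⟨m, hzm, hm⟩ := EReal.lt_iff_exists_real_btwn.mp hz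
  rw [EReal.coe_lt_coe_iff] at hzm
  have hnot : (m, δ, ((P.1, P.2, 0, 0) : Vec4 d1 d2 d3 d4)) ∉
      valueSet μ (fun u => k u θ γ) (fun u => g u θ γ) := by
    rintro ⟨F, hp, hF, hk, hd, c, ⟨hc1, hc2, hc3, hc4⟩, hv⟩
    obtain ⟨e1, hv⟩ := Prod.ext_iff.mp hv
    obtain ⟨e2, hv⟩ := Prod.ext_iff.mp hv
    obtain ⟨e3, e4⟩ := Prod.ext_iff.mp hv
    have hfeas : Feasible klPhi μ g δ θ γ P F := by
      refine ⟨hp, ?_, hG.gIntegrable hF, fun i => ?_, fun i => ?_, fun i => ?_, fun i => ?_⟩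
      · rw [Dphi_klPhi]
        exact ENNReal.le_ofReal_iff_toReal_le hF hδ.le |>.mpr hd
      · have h : P.1 i = ∫ u, (g u θ γ).1 i ∂F + c.1 i := congrFun e1 i
        linarith [hc1 i]
      · have h : P.2 i = ∫ u, (g u θ γ).2.1 i ∂F + c.2.1 i := congrFun e2 i
        simp [h, hc2]
      · have h : 0 = ∫ u, (g u θ γ).2.2.1 i ∂F + c.2.2.1 i := congrFun e3 i
        linarith [hc3 i]
      · have h : 0 = ∫ u, (g u θ γ).2.2.2 i ∂F + c.2.2.2 i := congrFun e4 i
        rw [h, hc4]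
        simp
    have hle : kappaLow klPhi μ g k δ θ γ P ≤ (∫ u, k u θ γ ∂F : ℝ) :=
      sInf_le ⟨F, hfeas, hK.integrable_of_klDiv_ne_top hF, rfl⟩
    exact absurd (EReal.coe_lt_coe_iff.mp (hm.trans_le hle)) (not_lt.mpr hk)
  obtain ⟨η, hη, l, hl, hbound⟩ := exists_multipliers hK hG hS hlt hnot
  have hε : 0 < (m - z) / δ := div_pos (by linarith) hδ
  have hη' : 0 < η + (m - z) / δ := by linarith
  refine le_sSup_of_le ⟨η + (m - z) / δ, hη', l, hl,
    ((hK.add (hG.dot4 l)).neg.div_const _).integrable_exp, rfl⟩ (EReal.coe_le_coe_iff.mpr ?_)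
  have hval := dual_value_of_forall_le hK hG hη' l fun F hp hF => (hbound F hp hF).trans
    (add_le_add_left (add_le_add_right
      (mul_le_mul_of_nonneg_right (le_add_of_nonneg_right hε.le) ENNReal.toReal_nonneg) _) _)
  have hεδ : (m - z) / δ * δ = m - z := div_mul_cancel₀ _ hδ.ne'
  linarith

lemma kappaLow_eq_klLowDual [IsProbabilityMeasure μ] (hK : MemExpE μ (fun u => k u θ γ))
    (hG : MemExpE4 μ (fun u => g u θ γ)) (hδ : 0 < δ)
    (hS : ((P.1, P.2, 0, 0) : Vec4 d1 d2 d3 d4) ∈ interior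
      ({v | ∃ F : Measure U, IsProbabilityMeasure F ∧ klDiv F μ ≠ ∞ ∧
        v = moments (fun u => g u θ γ) F} + coneC))
    (hlt : ∀ l : Vec4 d1 d2 d3 d4, inLambda l →
      -Real.log (∫ u, Real.exp (-(dot4 l (g u θ γ))) ∂μ) - dotP l P < δ) :
    kappaLow klPhi μ g k δ θ γ P = klLowDual μ g k δ θ γ P :=
  le_antisymm (kappaLow_le_klLowDual hK hG hδ hS hlt) (klLowDual_le_kappaLow hK hG hδ)

end Programs

end CFSens

open CFSens

/-- **Dual programs for Kullback–Leibler neighborhoods.**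
For `φ(x) = x log x - x + 1` (so `D_φ` is KL divergence and `ℰ` is the class of functions
with all exponential moments under `F*`), under Assumption Φ(ii), Condition S at `(θ,γ,P)`
and `δ*(θ;γ,P) < δ`, the extreme counterfactuals equal the KL dual programs, and
`δ*(θ;γ,P) = sup_{λ∈Λ} ( -log E^{F*}[exp(-λ'g)] - λ12'P )`. -/
theorem kl_dual_programs
    {U : Type*} [MeasurableSpace U] {dθ d1 d2 d3 d4 : ℕ} {Γ : Type*}
    (Fstar : Measure U) [IsProbabilityMeasure Fstar]
    (g : U → (Fin dθ → ℝ) → Γ → Vec4 d1 d2 d3 d4)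
    (k : U → (Fin dθ → ℝ) → Γ → ℝ)
    (Θ : Set (Fin dθ → ℝ))
    (hΦ2k : ∀ (θ : Fin dθ → ℝ) (γ : Γ), MemExpE Fstar (fun u => k u θ γ))
    (hΦ2g : ∀ (θ : Fin dθ → ℝ) (γ : Γ),
      (∀ i, MemExpE Fstar (fun u => (g u θ γ).1 i)) ∧
      (∀ i, MemExpE Fstar (fun u => (g u θ γ).2.1 i)) ∧
      (∀ i, MemExpE Fstar (fun u => (g u θ γ).2.2.1 i)) ∧
      (∀ i, MemExpE Fstar (fun u => (g u θ γ).2.2.2 i)))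
    (δ : ℝ) (hδ : 0 < δ)
    (θ : Fin dθ → ℝ) (hθ : θ ∈ Θ) (γ : Γ) (P : Vec12 d1 d2)
    (hS : ConditionS klPhi Fstar g θ γ P)
    (hδs : deltaStar klPhi Fstar g θ γ P < ((δ : ℝ) : EReal)) :
    kappaLow klPhi Fstar g k δ θ γ P = klLowDual Fstar g k δ θ γ P ∧
    kappaHigh klPhi Fstar g k δ θ γ P = klHighDual Fstar g k δ θ γ P ∧
    deltaStar klPhi Fstar g θ γ P = klDeltaStar Fstar g θ γ P := by
  have hsub : interior (momentSet klPhi Fstar g θ γ + coneC) ⊆ interior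
      ({v | ∃ F : Measure U, IsProbabilityMeasure F ∧ InformationTheory.klDiv F Fstar ≠ ∞ ∧
        v = moments (fun u => g u θ γ) F} + coneC) := by
    refine interior_mono (Set.add_subset_add_right ?_)
    rintro v ⟨F, hp, hF, -, rfl⟩
    exact ⟨F, hp, (Dphi_klPhi Fstar F ▸ hF).ne, rfl⟩
  have hstar := deltaStar_klPhi (hΦ2g θ γ) P
  have hlt : ∀ l : Vec4 d1 d2 d3 d4, inLambda l →
      -Real.log (∫ u, Real.exp (-(dot4 l (g u θ γ))) ∂Fstar) - dotP l P < δ := fun l hl => by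
    have h : ((-Real.log (∫ u, Real.exp (-(dot4 l (g u θ γ))) ∂Fstar) - dotP l P : ℝ) : EReal) ≤
        klDeltaStar Fstar g θ γ P :=
      le_sSup ⟨l, hl, (MemExpE4.dot4 (hΦ2g θ γ) l).neg.integrable_exp, rfl⟩
    exact EReal.coe_lt_coe_iff.mp (h.trans_lt (hstar ▸ hδs))
  refine ⟨kappaLow_eq_klLowDual (hΦ2k θ γ) (hΦ2g θ γ) hδ (hsub hS) hlt, ?_, hstar⟩
  rw [kappaHigh_eq_neg_kappaLow, klHighDual_eq_neg_klLowDual,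
    kappaLow_eq_klLowDual (k := fun u θ γ => -k u θ γ) (hΦ2k θ γ).neg (hΦ2g θ γ) hδ (hsub hS) hlt]
end
end
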